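/- arXiv:1103.1543 — 2 statements merged into one kernel-verified Lean document; each statement's English description precedes it below -/
import Mathlib

section
/- Let μ and ν be Borel probability measures on ℝⁿ with finite second moments. Let B ⊂ ℝⁿ be a closed ball with radius r(B) ≥ c₃⁻¹, and suppose μ(int B) > 0 and ν(int B) > 0. Assume that the restriction of μ to B is absolutely continuous with respect to Lebesgue measure, μ⌊B = f(x)dx, where c₄⁻¹ ≤ f(x) ≤ c₄ for a.e. x ∈ B. Let φ : ℝⁿ → [0,1] be a Lipschitz function supported on B which is radial with respect to the center of B and satisfies c₂⁻¹·dist(x,∂B)² ≤ φ(x) ≤ c₂·dist(x,∂B)² and |∇φ(x)| ≤ c₂·dist(x,∂B) for all x ∈ B. Then W₂(φμ, a·φν) ≤ c·W₂(μ,ν), where a = (∫φ dμ)/(∫φ dν) and c depends only on n, c₂, c₃ and c₄. -/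
open MeasureTheory Metric Set ENNReal
open scoped NNReal

noncomputable section

/-- The `p`-th Wasserstein distance between two measures, as a value in `ℝ≥0∞`:
the infimum over all transference plans `π` (measures on `E × E` with marginals `μ` and `ν`)
of `(∫ |x - y|^p dπ)^(1/p)`. -/
def Wp {E : Type*} [EMetricSpace E] [MeasurableSpace E] (p : ℝ) (μ ν : Measure E) : ℝ≥0∞ :=
  ⨅ π ∈ {π : Measure (E × E) | π.map Prod.fst = μ ∧ π.map Prod.snd = ν},
    (∫⁻ z, edist z.1 z.2 ^ p ∂π) ^ (1 / p)

/-- The squared quadratic transport cost between two measures. -/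
def W2sq {E : Type*} [EMetricSpace E] [MeasurableSpace E] (μ ν : Measure E) : ℝ≥0∞ :=
  ⨅ π ∈ {π : Measure (E × E) | π.map Prod.fst = μ ∧ π.map Prod.snd = ν},
    ∫⁻ z, edist z.1 z.2 ^ 2 ∂π

section W2sq

variable {E F : Type*} [MetricSpace E] [MeasurableSpace E] [BorelSpace E]
  [SecondCountableTopology E] [MetricSpace F] [MeasurableSpace F] [BorelSpace F]
  [SecondCountableTopology F]

omit [BorelSpace E] [SecondCountableTopology E] in
lemma W2sq_le {μ ν : Measure E} (π : Measure (E × E)) (h₁ : π.map Prod.fst = μ)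
    (h₂ : π.map Prod.snd = ν) : W2sq μ ν ≤ ∫⁻ z, edist z.1 z.2 ^ 2 ∂π :=
  iInf₂_le π ⟨h₁, h₂⟩

omit [BorelSpace E] [SecondCountableTopology E] in
lemma le_mul_W2sq_add {μ ν : Measure E} {c T X : ℝ≥0∞} (hc : c ≠ 0) (hc' : c ≠ ⊤)
    (h : ∀ π : Measure (E × E), π.map Prod.fst = μ → π.map Prod.snd = ν →
      X ≤ c * ∫⁻ z, edist z.1 z.2 ^ 2 ∂π + T) : X ≤ c * W2sq μ ν + T := by
  rw [← tsub_le_iff_right, mul_comm, ← ENNReal.div_le_iff_le_mul (Or.inl hc) (Or.inl hc')]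
  refine le_iInf₂ fun π hπ => ?_
  rw [ENNReal.div_le_iff_le_mul (Or.inl hc) (Or.inl hc'), mul_comm, tsub_le_iff_right]
  exact h π hπ.1 hπ.2

lemma measurable_edist_sq : Measurable fun z : E × E => edist z.1 z.2 ^ 2 :=
  (measurable_fst.edist measurable_snd).pow_const 2

lemma W2sq_map_right_le {μ : Measure E} {T : E → E} (hT : Measurable T) :
    W2sq μ (μ.map T) ≤ ∫⁻ x, edist x (T x) ^ 2 ∂μ := by
  have hm : Measurable fun x => (x, T x) := measurable_id.prodMk hT
  refine (W2sq_le (μ.map fun x => (x, T x)) ?_ ?_).trans ?_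
  · rw [Measure.map_map measurable_fst hm]
    exact Measure.map_id
  · rw [Measure.map_map measurable_snd hm]
    rfl
  · rw [lintegral_map measurable_edist_sq hm]

lemma W2sq_self (μ : Measure E) : W2sq μ μ = 0 := by
  have h := W2sq_map_right_le (μ := μ) (T := id) measurable_id
  simpa using h

lemma W2sq_map_le {μ ν : Measure E} {f : E → F} {K : ℝ≥0} (hK : K ≠ 0) (hf : LipschitzWith K f) :
    W2sq (μ.map f) (ν.map f) ≤ (K : ℝ≥0∞) ^ 2 * W2sq μ ν := by
  have hfm : Measurable f := hf.continuous.measurable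
  have hm : Measurable (Prod.map f f) := hfm.prodMap hfm
  rw [← add_zero ((K : ℝ≥0∞) ^ 2 * W2sq μ ν)]
  refine le_mul_W2sq_add (by simpa using hK) (by simp) fun π h₁ h₂ => ?_
  refine (W2sq_le (π.map (Prod.map f f)) ?_ ?_).trans ?_
  · rw [Measure.map_map measurable_fst hm, ← h₁, Measure.map_map hfm measurable_fst]
    rfl
  · rw [Measure.map_map measurable_snd hm, ← h₂, Measure.map_map hfm measurable_snd]
    rfl
  · rw [lintegral_map measurable_edist_sq hm, add_zero,
      ← lintegral_const_mul _ measurable_edist_sq]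
    refine lintegral_mono fun z => ?_
    rw [← mul_pow]
    exact pow_le_pow_left' (hf z.1 z.2) 2

lemma W2sq_symm_le (μ ν : Measure E) : W2sq μ ν ≤ W2sq ν μ := by
  rw [← one_mul (W2sq ν μ), ← add_zero (1 * W2sq ν μ)]
  refine le_mul_W2sq_add one_ne_zero one_ne_top fun π h₁ h₂ => ?_
  refine (W2sq_le (π.map Prod.swap) ?_ ?_).trans ?_
  · rw [Measure.map_map measurable_fst measurable_swap, ← h₂]
    rfl
  · rw [Measure.map_map measurable_snd measurable_swap, ← h₁]
    rfl
  · rw [lintegral_map measurable_edist_sq measurable_swap, add_zero, one_mul]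
    simp [edist_comm]

omit [BorelSpace E] [SecondCountableTopology E] in
lemma W2sq_smul_le {c : ℝ≥0∞} (hc : c ≠ 0) (hc' : c ≠ ⊤) (μ ν : Measure E) :
    W2sq (c • μ) (c • ν) ≤ c * W2sq μ ν := by
  rw [← add_zero (c * W2sq μ ν)]
  refine le_mul_W2sq_add hc hc' fun π h₁ h₂ => ?_
  refine (W2sq_le (c • π) ?_ ?_).trans ?_
  · rw [Measure.map_smul, h₁]
  · rw [Measure.map_smul, h₂]
  · rw [lintegral_smul_measure, add_zero, smul_eq_mul]

omit [BorelSpace E] [SecondCountableTopology E] in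
lemma W2sq_add_le (μ₁ ν₁ μ₂ ν₂ : Measure E) :
    W2sq (μ₁ + μ₂) (ν₁ + ν₂) ≤ W2sq μ₁ ν₁ + W2sq μ₂ ν₂ := by
  rw [← one_mul (W2sq μ₁ ν₁)]
  refine le_mul_W2sq_add one_ne_zero one_ne_top fun π h₁ h₂ => ?_
  rw [add_comm (1 * _), ← one_mul (W2sq μ₂ ν₂)]
  refine le_mul_W2sq_add one_ne_zero one_ne_top fun π' h₁' h₂' => ?_
  refine (W2sq_le (π + π') ?_ ?_).trans ?_
  · rw [Measure.map_add _ _ measurable_fst, h₁, h₁']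
  · rw [Measure.map_add _ _ measurable_snd, h₂, h₂']
  · rw [lintegral_add_measure, one_mul, one_mul, add_comm]

lemma W2sq_le_of_bounded {μ ν : Measure E} [IsFiniteMeasure μ] [IsFiniteMeasure ν]
    (h : μ univ = ν univ) {s : Set E} (hμ : μ sᶜ = 0) (hν : ν sᶜ = 0) {D : ℝ≥0∞}
    (hD : ∀ x ∈ s, ∀ y ∈ s, edist x y ≤ D) : W2sq μ ν ≤ D ^ 2 * μ univ := by
  by_cases h0 : μ univ = 0
  · have hμ0 : μ = 0 := Measure.measure_univ_eq_zero.1 h0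
    have hν0 : ν = 0 := Measure.measure_univ_eq_zero.1 (h ▸ h0)
    rw [hμ0, hν0, W2sq_self]
    exact bot_le
  have ht : μ univ ≠ ⊤ := measure_ne_top _ _
  refine (W2sq_le ((μ univ)⁻¹ • μ.prod ν) ?_ ?_).trans ?_
  · rw [Measure.map_smul, Measure.map_fst_prod, ← h, smul_smul, ENNReal.inv_mul_cancel h0 ht,
      one_smul]
  · rw [Measure.map_smul, Measure.map_snd_prod, smul_smul, ENNReal.inv_mul_cancel h0 ht, one_smul]
  · rw [lintegral_smul_measure, lintegral_prod _ measurable_edist_sq.aemeasurable, smul_eq_mul]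
    have : ∫⁻ x, ∫⁻ y, edist x y ^ 2 ∂ν ∂μ ≤ ∫⁻ _, ∫⁻ _, D ^ 2 ∂ν ∂μ := by
      refine lintegral_mono_ae ?_
      filter_upwards [compl_mem_ae_iff.2 hμ] with x hx
      refine lintegral_mono_ae ?_
      filter_upwards [compl_mem_ae_iff.2 hν] with y hy
      exact pow_le_pow_left' (hD x (by simpa using hx) y (by simpa using hy)) 2
    refine (mul_le_mul_right this _).trans ?_
    rw [lintegral_const, lintegral_const, ← h, mul_comm, mul_assoc, ENNReal.mul_inv_cancel h0 ht,
      mul_one]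

omit [MeasurableSpace E] [BorelSpace E] [SecondCountableTopology E] in
lemma edist_sq_le_add {ε : ℝ≥0} (hε : ε ≠ 0) (x y z : E) :
    edist x z ^ 2 ≤ ((1 + ε⁻¹ : ℝ≥0) : ℝ≥0∞) * edist x y ^ 2 +
      ((1 + ε : ℝ≥0) : ℝ≥0∞) * edist y z ^ 2 := by
  simp only [edist_nndist]
  norm_cast
  rw [← NNReal.coe_le_coe]
  push_cast
  have h := dist_triangle x y z
  have hε' : (0 : ℝ) < ε := by positivity
  have h1 : (dist x z) ^ 2 ≤ (dist x y + dist y z) ^ 2 := by gcongr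
  have h2 : 0 ≤ (ε : ℝ)⁻¹ * (dist x y - ε * dist y z) ^ 2 := by positivity
  have h3 : (ε : ℝ)⁻¹ * (dist x y - ε * dist y z) ^ 2 =
      (ε : ℝ)⁻¹ * dist x y ^ 2 - 2 * dist x y * dist y z + ε * dist y z ^ 2 := by
    field_simp
    ring
  nlinarith

lemma W2sq_triangle [StandardBorelSpace E] [Nonempty E] {μ ν ρ : Measure E}
    [IsFiniteMeasure ν] {ε : ℝ≥0} (hε : ε ≠ 0) :
    W2sq μ ρ ≤ ((1 + ε⁻¹ : ℝ≥0) : ℝ≥0∞) * W2sq μ ν + ((1 + ε : ℝ≥0) : ℝ≥0∞) * W2sq ν ρ := by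
  refine le_mul_W2sq_add (by simp) (by simp) fun π₁ h₁ h₁' => ?_
  rw [add_comm]
  refine le_mul_W2sq_add (by simp) (by simp) fun π₂ h₂ h₂' => ?_
  have hf₁ : IsFiniteMeasure π₁ := by
    refine ⟨?_⟩
    have : π₁ univ = ν univ := by rw [← h₁', Measure.map_apply measurable_snd .univ, preimage_univ]
    rw [this]
    exact measure_lt_top _ _
  have hf₂ : IsFiniteMeasure π₂ := by
    refine ⟨?_⟩
    have : π₂ univ = ν univ := by rw [← h₂, Measure.map_apply measurable_fst .univ, preimage_univ]
    rw [this]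
    exact measure_lt_top _ _
  set κ := π₂.condKernel with hκ
  set γ : Measure ((E × E) × E) := π₁.compProd (κ.comap Prod.snd measurable_snd) with hγ
  have hdis : ν.compProd κ = π₂ := by
    have := Measure.disintegrate π₂ π₂.condKernel
    rwa [Measure.fst, h₂] at this
  have hfst : γ.map Prod.fst = π₁ := Measure.fst_compProd _ _
  have hm : Measurable fun z : (E × E) × E => (z.1.2, z.2) := by fun_prop
  have hm' : Measurable fun z : (E × E) × E => (z.1.1, z.2) := by fun_prop
  have hyz : γ.map (fun z => (z.1.2, z.2)) = π₂ := by
    rw [← hdis, ← h₁']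
    refine Measure.ext_of_lintegral _ fun f hf => ?_
    rw [lintegral_map hf hm, hγ, Measure.lintegral_compProd
        (f := fun z : (E × E) × E => f (z.1.2, z.2)) (hf.comp hm),
      Measure.lintegral_compProd hf, lintegral_map _ measurable_snd]
    · rfl
    · exact hf.lintegral_kernel_prod_right'
  refine (W2sq_le (γ.map fun z => (z.1.1, z.2)) ?_ ?_).trans ?_
  · rw [Measure.map_map measurable_fst hm', ← h₁, ← hfst, Measure.map_map measurable_fst
      measurable_fst]
    rfl
  · rw [Measure.map_map measurable_snd hm', ← h₂', ← hyz, Measure.map_map measurable_snd hm]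
    rfl
  · rw [lintegral_map measurable_edist_sq hm', ← hfst, lintegral_map measurable_edist_sq
      measurable_fst, ← hyz, lintegral_map measurable_edist_sq hm, add_comm,
      ← lintegral_const_mul' _ _ coe_ne_top, ← lintegral_const_mul' _ _ coe_ne_top,
      ← lintegral_add_left]
    · exact lintegral_mono fun z => edist_sq_le_add hε _ _ _
    · exact (measurable_edist_sq.comp measurable_fst).const_mul _

end W2sq

/-- Transport inequality of Poincaré type: bounded densities `p ≥ 1 / 2` with respect to `m`, of the
same total mass as `m`, are at squared transport cost at most `C * ∫ (p - 1) ^ 2` from `m`. -/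
def TransportPoincare {E : Type*} [EMetricSpace E] [MeasurableSpace E] (m : Measure E)
    (C : ℝ≥0) : Prop :=
  ∀ p : E → ℝ, Measurable p → (∀ x, 1 / 2 ≤ p x) → (∃ M, ∀ x, p x ≤ M) →
    m.withDensity (fun x => ENNReal.ofReal (p x)) univ = m univ →
    W2sq m (m.withDensity fun x => ENNReal.ofReal (p x)) ≤
      C * ∫⁻ x, ENNReal.ofReal ((p x - 1) ^ 2) ∂m

lemma map_withDensity_comp {E F : Type*} [MeasurableSpace E] [MeasurableSpace F] (m : Measure E)
    {f : E → F} (hf : Measurable f) {p : F → ℝ≥0∞} (hp : Measurable p) :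
    (m.map f).withDensity p = (m.withDensity (p ∘ f)).map f := by
  ext s hs
  rw [withDensity_apply _ hs, Measure.map_apply hf hs, withDensity_apply _ (hf hs),
    setLIntegral_map hs hp hf]
  rfl

lemma ofReal_sq_integral_le {Ω : Type*} [MeasurableSpace Ω] (κ : Measure Ω) [IsProbabilityMeasure κ]
    {u : Ω → ℝ} (hu : Measurable u) {M : ℝ} (hM : ∀ x, |u x| ≤ M) :
    ENNReal.ofReal ((∫ x, u x ∂κ) ^ 2) ≤ ∫⁻ x, ENNReal.ofReal (u x ^ 2) ∂κ := by
  have hi : Integrable u κ := Integrable.of_bound hu.aestronglyMeasurable M (.of_forall hM)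
  have hi2 : Integrable (fun x => u x ^ 2) κ := by
    refine Integrable.of_bound (hu.pow_const 2).aestronglyMeasurable (M ^ 2) (.of_forall fun x => ?_)
    rw [Real.norm_eq_abs, abs_pow]
    exact pow_le_pow_left₀ (abs_nonneg _) (hM x) 2
  rw [← ofReal_integral_eq_lintegral_ofReal hi2 (.of_forall fun x => sq_nonneg _)]
  refine ofReal_le_ofReal ?_
  set c := ∫ x, u x ∂κ
  have h : 0 ≤ ∫ x, (u x - c) ^ 2 ∂κ := integral_nonneg fun x => sq_nonneg _
  have h' : ∫ x, (u x - c) ^ 2 ∂κ = ∫ x, u x ^ 2 ∂κ - c ^ 2 := by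
    have : ∀ x, (u x - c) ^ 2 = u x ^ 2 - (2 * c * u x - c ^ 2) := fun x => by ring
    simp_rw [this]
    have hs : Integrable (fun x => 2 * c * u x - c ^ 2) κ :=
      (hi.const_mul _).sub (integrable_const _)
    rw [integral_sub hi2 hs,
      integral_sub (hi.const_mul _) (integrable_const _), integral_const_mul]
    simp only [integral_const, probReal_univ, one_smul]
    ring
  linarith

section TransportPoincare

variable {E F : Type*} [MetricSpace E] [MeasurableSpace E] [BorelSpace E]
  [SecondCountableTopology E] [MetricSpace F] [MeasurableSpace F] [BorelSpace F]
  [SecondCountableTopology F]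

lemma TransportPoincare.of_subsingleton [Subsingleton E] (m : Measure E) [IsFiniteMeasure m]
    (C : ℝ≥0) : TransportPoincare m C := by
  intro p hp _ _ h
  have : IsFiniteMeasure (m.withDensity fun x => ENNReal.ofReal (p x)) :=
    ⟨by rw [h]; exact measure_lt_top _ _⟩
  refine (W2sq_le_of_bounded (D := 0) h.symm (s := univ) (by simp) (by simp) ?_).trans ?_
  · intro x _ y _
    rw [Subsingleton.elim x y, edist_self]
  · simp

lemma TransportPoincare.map {m : Measure E} {C : ℝ≥0} (h : TransportPoincare m C) {f : E → F}
    {K : ℝ≥0} (hK : K ≠ 0) (hf : LipschitzWith K f) :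
    TransportPoincare (m.map f) (K ^ 2 * C) := by
  intro p hp hp' ⟨M, hM⟩ hmass
  have hfm : Measurable f := hf.continuous.measurable
  have hpm : Measurable fun x => ENNReal.ofReal (p x) := hp.ennreal_ofReal
  rw [map_withDensity_comp m hfm hpm] at hmass ⊢
  rw [Measure.map_apply hfm .univ, Measure.map_apply hfm .univ, preimage_univ] at hmass
  refine (W2sq_map_le hK hf).trans ?_
  rw [lintegral_map ((hp.sub_const 1).pow_const 2).ennreal_ofReal hfm]
  push_cast
  rw [mul_assoc]
  gcongr
  exact h (p ∘ f) (hp.comp hfm) (fun x => hp' _) ⟨M, fun x => hM _⟩ hmass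

end TransportPoincare

/-- The Lebesgue measure on the interval `[-1/2, 1/2]`. -/
def unifI : Measure ℝ := volume.restrict (Icc (-(1 / 2)) (1 / 2))

instance : IsProbabilityMeasure unifI := ⟨by
  rw [unifI, Measure.restrict_apply_univ, Real.volume_Icc]
  norm_num⟩

section Cdf

variable {p : ℝ → ℝ} {M : ℝ}

lemma intervalIntegrable_of_bounds (hp : Measurable p) (h₁ : ∀ x, 1 / 2 ≤ p x)
    (h₂ : ∀ x, p x ≤ M) (a b : ℝ) : IntervalIntegrable p volume a b := by
  rw [intervalIntegrable_iff]
  refine Measure.integrableOn_of_bounded (M := M) (by simp) hp.aestronglyMeasurable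
    (.of_forall fun x => ?_)
  rw [Real.norm_eq_abs, abs_of_nonneg (by linarith [h₁ x])]
  exact h₂ x

lemma half_sub_le_integral (hp : Measurable p) (h₁ : ∀ x, 1 / 2 ≤ p x)
    (h₂ : ∀ x, p x ≤ M) {x y : ℝ} (hxy : x ≤ y) :
    (y - x) / 2 ≤ (∫ t in (-(1 / 2))..y, p t) - ∫ t in (-(1 / 2))..x, p t := by
  have hi := intervalIntegrable_of_bounds hp h₁ h₂
  rw [intervalIntegral.integral_interval_sub_left (hi _ _) (hi _ _)]
  have := intervalIntegral.integral_mono_on hxy (f := fun _ => (1 / 2 : ℝ)) (by simp) (hi x y)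
    fun t _ => h₁ t
  rw [intervalIntegral.integral_const, smul_eq_mul] at this
  linarith

lemma unifI_withDensity_Iic (hp : Measurable p) (h₁ : ∀ x, 1 / 2 ≤ p x)
    (h₂ : ∀ x, p x ≤ M) (s : ℝ) :
    unifI.withDensity (fun x => ENNReal.ofReal (p x)) (Iic s) =
      ENNReal.ofReal (∫ t in (-(1 / 2))..(min s (1 / 2)), p t) := by
  rw [withDensity_apply _ measurableSet_Iic, unifI, Measure.restrict_restrict measurableSet_Iic]
  have hset : Iic s ∩ Icc (-(1 / 2)) (1 / 2) = Icc (-(1 / 2)) (min s (1 / 2)) := by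
    ext x
    simp only [mem_inter_iff, mem_Iic, mem_Icc, le_min_iff]
    tauto
  rw [hset]
  rcases le_or_gt (-(1 / 2)) (min s (1 / 2)) with h | h
  · have hi := intervalIntegrable_of_bounds hp h₁ h₂ (-(1 / 2)) (min s (1 / 2))
    rw [intervalIntegral.integral_of_le h, ← integral_Icc_eq_integral_Ioc,
      ofReal_integral_eq_lintegral_ofReal]
    · rwa [← IntegrableOn, integrableOn_Icc_iff_integrableOn_Ioc,
        ← intervalIntegrable_iff_integrableOn_Ioc_of_le h]
    · exact .of_forall fun x => by simp only [Pi.zero_apply]; linarith [h₁ x]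
  · rw [Icc_eq_empty (not_le.2 h)]
    have := half_sub_le_integral hp h₁ h₂ h.le
    rw [intervalIntegral.integral_same] at this
    rw [ofReal_of_nonpos (by linarith)]
    simp

lemma integral_unifI (p : ℝ → ℝ) : ∫ t, p t ∂unifI = ∫ t in (-(1 / 2))..(1 / 2), p t := by
  rw [unifI, integral_Icc_eq_integral_Ioc, intervalIntegral.integral_of_le (by norm_num)]

lemma map_cdf_unifI (hp : Measurable p) (h₁ : ∀ x, 1 / 2 ≤ p x) (h₂ : ∀ x, p x ≤ M)
    {P : ℝ} (hP : P = ∫ t, p t ∂unifI) :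
    (unifI.withDensity fun x => ENNReal.ofReal (p x)).map
        (fun y => -(1 / 2) + (∫ t in (-(1 / 2))..y, p t) / P) = ENNReal.ofReal P • unifI := by
  rw [integral_unifI] at hP
  set G : ℝ → ℝ := fun y => ∫ t in (-(1 / 2))..y, p t with hG
  have hi := intervalIntegrable_of_bounds hp h₁ h₂
  have hlow : ∀ {x y}, x ≤ y → (y - x) / 2 ≤ G y - G x := half_sub_le_integral hp h₁ h₂
  have hG0 : G (-(1 / 2)) = 0 := intervalIntegral.integral_same
  have hPpos : 0 < P := by
    have := hlow (show (-(1 / 2) : ℝ) ≤ 1 / 2 by norm_num)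
    rw [hG0, ← show P = G (1 / 2) from hP] at this
    linarith
  have hmono : StrictMono G := fun x y hxy => by linarith [hlow hxy.le]
  have hcont : Continuous G := intervalIntegral.continuous_primitive hi _
  have hsurj : Function.Surjective G := by
    refine hcont.surjective ?_ ?_
    · refine Filter.tendsto_atTop_mono' _ (f₁ := fun y : ℝ => (y + 1 / 2) / 2) ?_ ?_
      · filter_upwards [Filter.eventually_ge_atTop (-(1 / 2))] with y hy
        linarith [hlow hy]
      · exact (Filter.tendsto_atTop_add_const_right _ _ Filter.tendsto_id).atTop_div_const
          (by norm_num)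
    · refine Filter.tendsto_atBot_mono' _ (f₁ := fun y : ℝ => (y + 1 / 2) / 2) ?_ ?_
      · filter_upwards [Filter.eventually_le_atBot (-(1 / 2))] with y hy
        linarith [hlow hy]
      · exact (Filter.tendsto_atBot_add_const_right _ _ Filter.tendsto_id).atBot_div_const
          (by norm_num)
  have hSm : Measurable fun y => -(1 / 2) + G y / P := by
    have := hcont.measurable
    fun_prop
  have hfin : IsFiniteMeasure (unifI.withDensity fun x => ENNReal.ofReal (p x)) := by
    refine isFiniteMeasure_withDensity (ne_top_of_le_ne_top (b := ENNReal.ofReal M) (by simp) ?_)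
    refine (lintegral_mono fun x => ofReal_le_ofReal (h₂ x)).trans ?_
    simp
  refine Measure.ext_of_Iic _ _ fun b => ?_
  obtain ⟨s, hs⟩ := hsurj (P * (b + 1 / 2))
  have hpre : (fun y => -(1 / 2) + G y / P) ⁻¹' Iic b = Iic s := by
    ext y
    rw [mem_preimage, mem_Iic, mem_Iic, ← hmono.le_iff_le (a := y), hs]
    rw [neg_add_le_iff_le_add, div_le_iff₀ hPpos, mul_comm, add_comm]
  have hU : unifI (Iic b) = ENNReal.ofReal (min b (1 / 2) + 1 / 2) := by
    have := unifI_withDensity_Iic (p := fun _ => 1) (M := 1) (by fun_prop) (by norm_num)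
      (by norm_num) b
    simpa using this
  rw [Measure.map_apply hSm measurableSet_Iic, hpre, unifI_withDensity_Iic hp h₁ h₂,
    Measure.smul_apply, hU, smul_eq_mul, ← ofReal_mul hPpos.le]
  congr 1
  change G (min s (1 / 2)) = _
  rw [hmono.monotone.map_min, hs, ← show P = G (1 / 2) from hP, min_add, mul_min_of_nonneg _ _
    hPpos.le]
  norm_num

end Cdf

section Cdf

variable {p : ℝ → ℝ} {M : ℝ}

lemma abs_sub_cdf_le (hp : Measurable p) (h₁ : ∀ x, 1 / 2 ≤ p x) (h₂ : ∀ x, p x ≤ M)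
    {P : ℝ} (hP : P = ∫ t, p t ∂unifI) {y : ℝ} (hy : y ∈ Icc (-(1 / 2) : ℝ) (1 / 2)) :
    |y - (-(1 / 2) + (∫ t in (-(1 / 2))..y, p t) / P)| ≤ 2 * (∫ t, |p t - 1| ∂unifI) / P := by
  have hi := intervalIntegrable_of_bounds hp h₁ h₂
  have hlow := half_sub_le_integral hp h₁ h₂ (show (-(1 / 2) : ℝ) ≤ 1 / 2 by norm_num)
  rw [intervalIntegral.integral_same] at hlow
  have hP' := hP
  rw [integral_unifI] at hP'
  have hPpos : 0 < P := by linarith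
  have hi1 : ∀ a b : ℝ, IntervalIntegrable (fun t => p t - 1) volume a b := fun a b =>
    (hi a b).sub (by simp)
  rw [integral_unifI]
  set A := ∫ t in (-(1 / 2))..(1 / 2), |p t - 1| with hA
  have hA1 : |∫ t in (-(1 / 2))..y, (p t - 1)| ≤ A := by
    refine (intervalIntegral.abs_integral_le_integral_abs hy.1).trans ?_
    refine intervalIntegral.integral_mono_interval le_rfl hy.1 hy.2
      (.of_forall fun t => abs_nonneg _) (hi1 _ _).abs
  have hA2 : |P - 1| ≤ A := by
    have : P - 1 = ∫ t in (-(1 / 2))..(1 / 2), (p t - 1) := by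
      rw [intervalIntegral.integral_sub (hi _ _) (by simp), ← hP']
      norm_num
    rw [this]
    exact intervalIntegral.abs_integral_le_integral_abs (by norm_num)
  have heq : y - (-(1 / 2) + (∫ t in (-(1 / 2))..y, p t) / P) =
      ((P - 1) * (y + 1 / 2) - ∫ t in (-(1 / 2))..y, (p t - 1)) / P := by
    rw [intervalIntegral.integral_sub (hi _ _) (by simp), intervalIntegral.integral_const,
      smul_eq_mul]
    field_simp
    ring
  rw [heq, abs_div, abs_of_pos hPpos]
  gcongr
  refine (abs_sub _ _).trans ?_
  have h3 : |(P - 1) * (y + 1 / 2)| ≤ A := by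
    rw [abs_mul, abs_of_nonneg (show 0 ≤ y + 1 / 2 by linarith [hy.1])]
    nlinarith [hy.2, hy.1, abs_nonneg (P - 1)]
  linarith

lemma lintegral_edist_cdf_le (hp : Measurable p) (h₁ : ∀ x, 1 / 2 ≤ p x) (h₂ : ∀ x, p x ≤ M)
    {P : ℝ} (hP : P = ∫ t, p t ∂unifI) :
    ∫⁻ y, ENNReal.ofReal (p y) * edist y (-(1 / 2) + (∫ t in (-(1 / 2))..y, p t) / P) ^ 2 ∂unifI ≤
      8 * ∫⁻ t, ENNReal.ofReal ((p t - 1) ^ 2) ∂unifI := by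
  have hInt : Integrable p unifI := by
    refine Integrable.of_bound hp.aestronglyMeasurable M (.of_forall fun x => ?_)
    rw [Real.norm_eq_abs, abs_of_nonneg (by linarith [h₁ x])]
    exact h₂ x
  have hP2 : 1 / 2 ≤ P := by
    rw [hP]
    have := integral_mono (integrable_const (1 / 2 : ℝ)) hInt h₁
    simpa using this
  set A := ∫ t, |p t - 1| ∂unifI with hA
  have hjen : ENNReal.ofReal (A ^ 2) ≤ ∫⁻ t, ENNReal.ofReal ((p t - 1) ^ 2) ∂unifI := by
    refine (ofReal_sq_integral_le unifI (u := fun t => |p t - 1|) (M := |M| + 1) (by fun_prop)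
      fun t => ?_).trans_eq ?_
    · rw [abs_abs, abs_le]
      constructor <;> cases abs_cases M <;> linarith [h₁ t, h₂ t]
    · simp_rw [sq_abs]
  have hmain : ∀ᵐ y ∂unifI,
      ENNReal.ofReal (p y) * edist y (-(1 / 2) + (∫ t in (-(1 / 2))..y, p t) / P) ^ 2 ≤
        ENNReal.ofReal (p y) * ENNReal.ofReal ((2 * A / P) ^ 2) := by
    filter_upwards [ae_restrict_mem measurableSet_Icc] with y hy
    gcongr
    rw [edist_dist, ← ofReal_pow dist_nonneg, Real.dist_eq]
    refine ofReal_le_ofReal ?_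
    gcongr
    exact abs_sub_cdf_le hp h₁ h₂ hP hy
  refine (lintegral_mono_ae hmain).trans ?_
  rw [lintegral_mul_const _ hp.ennreal_ofReal, ← ofReal_integral_eq_lintegral_ofReal hInt
    (.of_forall fun x => by simp only [Pi.zero_apply]; linarith [h₁ x]), ← hP,
    ← ofReal_mul (by linarith)]
  refine le_trans (ofReal_le_ofReal (q := 8 * A ^ 2) ?_) ?_
  · rw [show P * (2 * A / P) ^ 2 = 4 * A ^ 2 / P by field_simp; ring, div_le_iff₀ (by linarith)]
    nlinarith [sq_nonneg A]
  · rw [ofReal_mul (by norm_num)]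
    simp only [ofReal_ofNat]
    gcongr

end Cdf

section Prod

variable {E F : Type*} [MetricSpace E] [MeasurableSpace E] [BorelSpace E]
  [SecondCountableTopology E] [MetricSpace F] [MeasurableSpace F] [BorelSpace F]
  [SecondCountableTopology F]

lemma W2sq_prod_le {μ ν : Measure E} [IsFiniteMeasure μ] {U : Measure F}
    [IsProbabilityMeasure U] : W2sq (μ.prod U) (ν.prod U) ≤ W2sq μ ν := by
  rw [← one_mul (W2sq μ ν), ← add_zero (1 * W2sq μ ν)]
  refine le_mul_W2sq_add one_ne_zero one_ne_top fun π h₁ h₂ => ?_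
  have hf : IsFiniteMeasure π := by
    refine ⟨?_⟩
    have : π univ = μ univ := by rw [← h₁, Measure.map_apply measurable_fst .univ, preimage_univ]
    rw [this]
    exact measure_lt_top _ _
  have hm : Measurable fun z : (E × E) × F => ((z.1.1, z.2), (z.1.2, z.2)) := by fun_prop
  refine (W2sq_le ((π.prod U).map fun z => ((z.1.1, z.2), (z.1.2, z.2))) ?_ ?_).trans ?_
  · rw [Measure.map_map measurable_fst hm, ← h₁]
    have := Measure.map_prod_map π U measurable_fst measurable_id
    rw [Measure.map_id] at this
    rw [this]
    rfl
  · rw [Measure.map_map measurable_snd hm, ← h₂]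
    have := Measure.map_prod_map π U measurable_snd measurable_id
    rw [Measure.map_id] at this
    rw [this]
    rfl
  · rw [lintegral_map measurable_edist_sq hm, one_mul, add_zero,
      lintegral_prod (fun z : (E × E) × F => edist (z.1.1, z.2) (z.1.2, z.2) ^ 2)
        (measurable_edist_sq.comp hm).aemeasurable]
    simp [Prod.edist_eq]

lemma TransportPoincare.prod_unifI [StandardBorelSpace E] [Nonempty E] {m : Measure E}
    [IsFiniteMeasure m] {C : ℝ≥0} (h : TransportPoincare m C) :
    TransportPoincare (m.prod unifI) (2 * C + 16) := by
  intro p hp hp₁ ⟨M, hp₂⟩ hmass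
  set P : E → ℝ := fun x => ∫ t, p (x, t) ∂unifI with hP
  have hpx : ∀ x, Measurable fun t => p (x, t) := fun x => hp.comp measurable_prodMk_left
  have hPm : Measurable P := hp.stronglyMeasurable.integral_prod_right'.measurable
  have hInt : ∀ x, Integrable (fun t => p (x, t)) unifI := fun x => by
    refine Integrable.of_bound (hpx x).aestronglyMeasurable M (.of_forall fun t => ?_)
    rw [Real.norm_eq_abs, abs_of_nonneg (by linarith [hp₁ (x, t)])]
    exact hp₂ _
  have hP₁ : ∀ x, 1 / 2 ≤ P x := fun x => by
    have := integral_mono (integrable_const (1 / 2 : ℝ)) (hInt x) fun t => hp₁ _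
    simpa using this
  have hP₂ : ∀ x, P x ≤ M := fun x => by
    have := integral_mono (hInt x) (integrable_const M) fun t => hp₂ _
    simpa using this
  have hPl : ∀ x, ∫⁻ t, ENNReal.ofReal (p (x, t)) ∂unifI = ENNReal.ofReal (P x) := fun x => by
    rw [← ofReal_integral_eq_lintegral_ofReal (hInt x)
      (.of_forall fun t => by simp only [Pi.zero_apply]; linarith [hp₁ (x, t)])]
  have hmass' : m.withDensity (fun x => ENNReal.ofReal (P x)) univ = m univ := by
    rw [withDensity_apply _ .univ, Measure.restrict_univ, lintegral_prod _
      hp.ennreal_ofReal.aemeasurable] at hmass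
    rw [withDensity_apply _ .univ, Measure.restrict_univ]
    simp_rw [← hPl]
    rw [hmass, ← univ_prod_univ, Measure.prod_prod, measure_univ (μ := unifI), mul_one]
  have hfin : IsFiniteMeasure (m.withDensity fun x => ENNReal.ofReal (P x)) :=
    ⟨by rw [hmass']; exact measure_lt_top _ _⟩
  -- the fibrewise distribution function
  set S : E → ℝ → ℝ := fun x y => -(1 / 2) + (∫ t in (-(1 / 2))..y, p (x, t)) / P x with hS
  have hSm : Measurable fun z : E × ℝ => S z.1 z.2 := by
    have hu : Measurable (Function.uncurry fun (y : ℝ) (x : E) =>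
        ∫ t in (-(1 / 2))..y, p (x, t)) := by
      refine measurable_uncurry_of_continuous_of_measurable (fun x => ?_) fun y => ?_
      · exact intervalIntegral.continuous_primitive
          (intervalIntegrable_of_bounds (hpx x) (fun t => hp₁ _) fun t => hp₂ _) _
      · rw [show (fun x => ∫ t in (-(1 / 2))..y, p (x, t)) = fun x => (∫ t in Ioc (-(1 / 2)) y, p (x, t)) -
          ∫ t in Ioc y (-(1 / 2)), p (x, t) from rfl]
        exact hp.stronglyMeasurable.integral_prod_right'.measurable.sub
          hp.stronglyMeasurable.integral_prod_right'.measurable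
    exact ((hu.comp measurable_swap).div (hPm.comp measurable_fst)).const_add _
  have hTm : Measurable fun z : E × ℝ => (z.1, S z.1 z.2) := measurable_fst.prodMk hSm
  set ρ := (m.prod unifI).withDensity fun x => ENNReal.ofReal (p x) with hρ
  have hmap : ρ.map (fun z : E × ℝ => (z.1, S z.1 z.2)) =
      (m.withDensity fun x => ENNReal.ofReal (P x)).prod unifI := by
    refine (Measure.prod_eq fun s t hs ht => ?_).symm
    have hst := hTm (hs.prod ht)
    rw [Measure.map_apply hTm (hs.prod ht), hρ, withDensity_apply _ hst,
      withDensity_apply _ hs, ← lintegral_indicator hst,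
      lintegral_prod _ (hp.ennreal_ofReal.indicator hst).aemeasurable,
      ← lintegral_mul_const _ hPm.ennreal_ofReal, ← lintegral_indicator hs]
    refine lintegral_congr fun x => ?_
    have hcdf := map_cdf_unifI (hpx x) (fun t => hp₁ _) (fun t => hp₂ _) (P := P x) rfl
    have hSx : Measurable (S x) := hSm.comp measurable_prodMk_left
    by_cases hx : x ∈ s
    · have := congrArg (fun μ : Measure ℝ => μ t) hcdf
      rw [Measure.map_apply hSx ht, withDensity_apply _ (hSx ht), Measure.smul_apply, smul_eq_mul,
        ← lintegral_indicator (hSx ht)] at this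
      rw [indicator_of_mem hx, ← this]
      refine lintegral_congr fun y => ?_
      by_cases hy : S x y ∈ t
      · rw [indicator_of_mem (by exact ⟨hx, hy⟩), indicator_of_mem (by exact hy)]
      · rw [indicator_of_notMem (fun hh => hy hh.2), indicator_of_notMem (by exact hy)]
    · rw [indicator_of_notMem hx]
      refine (lintegral_congr fun y => ?_).trans lintegral_zero
      exact indicator_of_notMem (fun hh => hx hh.1) _
  have hcost : W2sq ((m.withDensity fun x => ENNReal.ofReal (P x)).prod unifI) ρ ≤
      8 * ∫⁻ z, ENNReal.ofReal ((p z - 1) ^ 2) ∂(m.prod unifI) := by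
    refine (W2sq_symm_le _ _).trans ?_
    rw [← hmap]
    refine (W2sq_map_right_le hTm).trans ?_
    have hm2 : Measurable fun z : E × ℝ => edist z (z.1, S z.1 z.2) ^ 2 :=
      (measurable_id.edist hTm).pow_const 2
    rw [hρ, lintegral_withDensity_eq_lintegral_mul _ hp.ennreal_ofReal hm2,
      lintegral_prod _ (hp.ennreal_ofReal.mul hm2).aemeasurable,
      lintegral_prod _ ((hp.sub_const 1).pow_const 2).ennreal_ofReal.aemeasurable,
      ← lintegral_const_mul' _ _ (by norm_num)]
    refine lintegral_mono fun x => ?_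
    refine le_trans (le_of_eq ?_) (lintegral_edist_cdf_le (hpx x) (fun t => hp₁ _) (fun t => hp₂ _)
      (P := P x) rfl)
    refine lintegral_congr fun y => ?_
    simp [Prod.edist_eq, hS]
  have hfirst : W2sq (m.prod unifI) ((m.withDensity fun x => ENNReal.ofReal (P x)).prod unifI) ≤
      C * ∫⁻ z, ENNReal.ofReal ((p z - 1) ^ 2) ∂(m.prod unifI) := by
    refine W2sq_prod_le.trans ((h P hPm hP₁ ⟨M, hP₂⟩ hmass').trans ?_)
    rw [lintegral_prod _ ((hp.sub_const 1).pow_const 2).ennreal_ofReal.aemeasurable]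
    gcongr with x
    have hP1 : P x - 1 = ∫ t, (p (x, t) - 1) ∂unifI := by
      rw [integral_sub (hInt x) (integrable_const _)]
      simp [hP]
    rw [hP1]
    refine ofReal_sq_integral_le unifI (M := |M| + 1) ((hpx x).sub_const 1) fun t => ?_
    rw [abs_le]
    constructor <;> cases abs_cases M <;> linarith [hp₁ (x, t), hp₂ (x, t)]
  refine (W2sq_triangle (ε := 1)
    (ν := (m.withDensity fun x => ENNReal.ofReal (P x)).prod unifI) one_ne_zero).trans ?_
  refine (add_le_add (mul_le_mul_right hfirst _) (mul_le_mul_right hcost _)).trans_eq ?_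
  rw [← mul_assoc, ← mul_assoc, ← add_mul]
  congr 1
  push_cast
  norm_num

end Prod

section Cube

lemma lipschitzWith_fin_cons (N : ℕ) :
    LipschitzWith 1 fun z : (Fin N → ℝ) × ℝ => (Fin.cons z.2 z.1 : Fin (N + 1) → ℝ) := by
  refine LipschitzWith.mk_one fun z w => ?_
  refine (dist_pi_le_iff dist_nonneg).2 fun i => ?_
  refine Fin.cases ?_ (fun j => ?_) i
  · simp only [Fin.cons_zero]
    exact le_max_right _ _
  · simp only [Fin.cons_succ]
    exact (dist_le_pi_dist z.1 w.1 j).trans (le_max_left _ _)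

lemma map_fin_cons_prod_unifI (N : ℕ) :
    ((Measure.pi fun _ : Fin N => unifI).prod unifI).map
      (fun z : (Fin N → ℝ) × ℝ => (Fin.cons z.2 z.1 : Fin (N + 1) → ℝ)) =
      Measure.pi fun _ : Fin (N + 1) => unifI := by
  have h := (measurePreserving_piFinSuccAbove (fun _ : Fin (N + 1) => unifI) 0).symm
  have h2 := h.comp (Measure.measurePreserving_swap (μ := Measure.pi fun _ : Fin N => unifI)
    (ν := unifI))
  rw [← h2.map_eq]
  congr 1
  ext1 z
  simp [MeasurableEquiv.piFinSuccAbove, Fin.insertNthEquiv]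

lemma exists_transportPoincare_pi (N : ℕ) :
    ∃ C : ℝ≥0, TransportPoincare (Measure.pi fun _ : Fin N => unifI) C := by
  induction N with
  | zero => exact ⟨0, .of_subsingleton _ _⟩
  | succ N ih =>
    obtain ⟨C, hC⟩ := ih
    refine ⟨1 ^ 2 * (2 * C + 16), ?_⟩
    rw [← map_fin_cons_prod_unifI N]
    exact hC.prod_unifI.map one_ne_zero (lipschitzWith_fin_cons N)

lemma pi_unifI_prod_eq (N : ℕ) :
    (Measure.pi fun _ : Fin N => unifI).prod (unifI.prod unifI) =
      (volume : Measure ((Fin N → ℝ) × (ℝ × ℝ))).restrict (closedBall 0 (1 / 2)) := by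
  have h : closedBall (0 : (Fin N → ℝ) × (ℝ × ℝ)) (1 / 2) =
      (univ.pi fun _ : Fin N => Icc (-(1 / 2) : ℝ) (1 / 2)) ×ˢ
        (Icc (-(1 / 2) : ℝ) (1 / 2) ×ˢ Icc (-(1 / 2) : ℝ) (1 / 2)) := by
    ext z
    rw [mem_closedBall_zero_iff, mem_prod, mem_prod, mem_univ_pi, Prod.norm_def, Prod.norm_def,
      sup_le_iff, sup_le_iff, pi_norm_le_iff_of_nonneg (by norm_num)]
    simp only [Real.norm_eq_abs, abs_le, mem_Icc]
  rw [h]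
  unfold unifI
  rw [← Measure.restrict_pi_pi, Measure.prod_restrict, Measure.prod_restrict]
  rfl

lemma exists_transportPoincare_cube (N : ℕ) :
    ∃ C : ℝ≥0, TransportPoincare
      ((volume : Measure ((Fin N → ℝ) × (ℝ × ℝ))).restrict (closedBall 0 (1 / 2))) C := by
  obtain ⟨C, hC⟩ := exists_transportPoincare_pi N
  refine ⟨1 ^ 2 * (2 * (2 * C + 16) + 16), ?_⟩
  rw [← pi_unifI_prod_eq, ← Measure.prodAssoc_prod]
  refine hC.prod_unifI.prod_unifI.map one_ne_zero (LipschitzWith.mk_one fun z w => ?_)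
  simp only [Prod.dist_eq, MeasurableEquiv.prodAssoc, MeasurableEquiv.coe_mk,
    Equiv.prodAssoc_apply]
  rw [max_assoc]

end Cube

section Comparable

lemma withDensity_ofReal_add {E : Type*} [MeasurableSpace E] (m : Measure E) {g h : E → ℝ}
    (hg : Measurable g) (hg' : ∀ x, 0 ≤ g x) (hh' : ∀ x, 0 ≤ h x) :
    m.withDensity (fun x => ENNReal.ofReal (g x + h x)) =
      m.withDensity (fun x => ENNReal.ofReal (g x)) +
        m.withDensity fun x => ENNReal.ofReal (h x) := by
  rw [← withDensity_add_left hg.ennreal_ofReal]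
  congr 1
  ext x
  exact ofReal_add (hg' x) (hh' x)

lemma withDensity_ofReal_const_mul {E : Type*} [MeasurableSpace E] (m : Measure E) {g : E → ℝ}
    {c : ℝ≥0} (hg : Measurable g) :
    m.withDensity (fun x => ENNReal.ofReal (c * g x)) =
      (c : ℝ≥0∞) • m.withDensity (fun x => ENNReal.ofReal (g x)) := by
  rw [← withDensity_smul _ hg.ennreal_ofReal]
  congr 1
  ext x
  rw [Pi.smul_apply, smul_eq_mul, ofReal_mul c.coe_nonneg, ofReal_coe_nnreal]

lemma withDensity_ofReal_withDensity_ofReal {E : Type*} [MeasurableSpace E] (m : Measure E)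
    {g h : E → ℝ} (hg : Measurable g) (hh : Measurable h) (hg' : ∀ x, 0 ≤ g x) :
    (m.withDensity fun x => ENNReal.ofReal (g x)).withDensity (fun x => ENNReal.ofReal (h x)) =
      m.withDensity fun x => ENNReal.ofReal (g x * h x) := by
  rw [← withDensity_mul _ hg.ennreal_ofReal hh.ennreal_ofReal]
  congr 1
  ext x
  exact (ofReal_mul (hg' x)).symm

lemma exists_density_of_comparable {E : Type*} [MeasurableSpace E] {m m' : Measure E}
    [IsFiniteMeasure m] [IsFiniteMeasure m'] {L : ℝ≥0} (hL : 1 ≤ L) (h₁ : m ≤ (L : ℝ≥0∞) • m')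
    (h₂ : m' ≤ (L : ℝ≥0∞) • m) :
    ∃ k : E → ℝ, Measurable k ∧ (∀ x, (L : ℝ)⁻¹ ≤ k x) ∧ (∀ x, k x ≤ L) ∧
      m' = m.withDensity fun x => ENNReal.ofReal (k x) := by
  have hL' : (1 : ℝ) ≤ L := by exact_mod_cast hL
  have hLL : (L : ℝ)⁻¹ ≤ L := (inv_le_one_of_one_le₀ hL').trans hL'
  have hac : m' ≪ m := Measure.absolutelyContinuous_of_le_smul h₂
  have hd := Measure.withDensity_rnDeriv_eq m' m hac
  have hup : m'.rnDeriv m ≤ᵐ[m] fun _ => (L : ℝ≥0∞) := by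
    refine ae_le_of_forall_setLIntegral_le_of_sigmaFinite (m'.measurable_rnDeriv m)
      fun s hs _ => (Measure.setLIntegral_rnDeriv_le s).trans ((h₂ s).trans_eq ?_)
    simp
  have hlow : (fun _ => (1 : ℝ≥0∞)) ≤ᵐ[m] fun x => L * m'.rnDeriv m x := by
    refine ae_le_of_forall_setLIntegral_le_of_sigmaFinite measurable_const fun s hs _ => ?_
    rw [lintegral_const_mul' _ _ coe_ne_top, Measure.setLIntegral_rnDeriv hac, setLIntegral_one]
    exact h₁ s
  refine ⟨fun x => max (L : ℝ)⁻¹ (min L (m'.rnDeriv m x).toReal), ?_, fun x => le_max_left _ _,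
    fun x => max_le hLL (min_le_left _ _), ?_⟩
  · have := (m'.measurable_rnDeriv m).ennreal_toReal
    fun_prop
  · rw [← hd]
    refine withDensity_congr_ae ?_
    filter_upwards [hup, hlow] with x hx hx'
    rw [hd]
    have hne : m'.rnDeriv m x ≠ ⊤ := ne_top_of_le_ne_top coe_ne_top hx
    lift m'.rnDeriv m x to ℝ≥0 using hne with y
    have hy : (y : ℝ) ≤ L := by exact_mod_cast hx
    have hy' : (1 : ℝ) ≤ L * y := by exact_mod_cast hx'
    rw [coe_toReal, min_eq_right hy, max_eq_right, ofReal_coe_nnreal]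
    rwa [inv_le_iff_one_le_mul₀' (by linarith)]

variable {E : Type*} [MetricSpace E] [MeasurableSpace E] [BorelSpace E]
  [SecondCountableTopology E] [StandardBorelSpace E] [Nonempty E]

lemma W2sq_le_of_interpolate {m ρ : Measure E} [IsFiniteMeasure m] [IsFiniteMeasure ρ] {s t : ℝ≥0}
    (ht : t ≠ 0) (hs : s ≠ 0) (hst : s + t = 1) (hfin : W2sq m ρ ≠ ⊤) :
    (t : ℝ≥0∞) ^ 2 * W2sq m ρ ≤
      ((1 + t⁻¹ : ℝ≥0) : ℝ≥0∞) * W2sq m ((s : ℝ≥0∞) • m + (t : ℝ≥0∞) • ρ) := by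
  obtain ⟨θ, hθ⟩ : ∃ θ, θ = (s : ℝ≥0∞) • m + (t : ℝ≥0∞) • ρ := ⟨_, rfl⟩
  rw [← hθ]
  have hfθ : IsFiniteMeasure θ := ⟨by
    rw [hθ, Measure.add_apply, Measure.smul_apply, Measure.smul_apply, smul_eq_mul, smul_eq_mul]
    exact ENNReal.add_lt_top.2 ⟨ENNReal.mul_lt_top coe_lt_top (measure_lt_top m _),
      ENNReal.mul_lt_top coe_lt_top (measure_lt_top ρ _)⟩⟩
  have h1 : W2sq θ ρ ≤ s * W2sq m ρ := by
    have hρ : (s : ℝ≥0∞) • ρ + (t : ℝ≥0∞) • ρ = ρ := by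
      rw [← add_smul, ← coe_add, hst, coe_one, one_smul]
    have h := W2sq_add_le ((s : ℝ≥0∞) • m) ((s : ℝ≥0∞) • ρ) ((t : ℝ≥0∞) • ρ) ((t : ℝ≥0∞) • ρ)
    rw [hρ, W2sq_self, add_zero, ← hθ] at h
    exact h.trans (W2sq_smul_le (by simpa using hs) coe_ne_top _ _)
  have h2 := W2sq_triangle (μ := m) (ν := θ) (ρ := ρ) ht
  have h3 := h2.trans (add_le_add_right (mul_le_mul_right h1 _) _)
  lift W2sq m ρ to ℝ≥0 using hfin with W
  by_cases hX : W2sq m θ = ⊤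
  · rw [hX, mul_top (by simp)]
    exact le_top
  lift W2sq m θ to ℝ≥0 using hX with X
  norm_cast at h3 ⊢
  rw [← NNReal.coe_le_coe] at h3 ⊢
  have hst' : (s : ℝ) + t = 1 := by exact_mod_cast hst
  push_cast at h3 ⊢
  have hs' : (s : ℝ) = 1 - t := by linarith
  rw [hs'] at h3
  nlinarith

lemma TransportPoincare.of_comparable {m m' : Measure E} [IsFiniteMeasure m] [IsFiniteMeasure m']
    {C L : ℝ≥0} (h : TransportPoincare m C) (hL : 1 ≤ L) (h₁ : m ≤ (L : ℝ≥0∞) • m')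
    (h₂ : m' ≤ (L : ℝ≥0∞) • m) {p : E → ℝ} (hp : Measurable p) (hp₀ : ∀ x, 0 ≤ p x) {M : ℝ}
    (hM : ∀ x, p x ≤ M)
    (hmass : m'.withDensity (fun x => ENNReal.ofReal (p x)) univ = m' univ)
    (hfin : W2sq m' (m'.withDensity fun x => ENNReal.ofReal (p x)) ≠ ⊤) :
    W2sq m' (m'.withDensity fun x => ENNReal.ofReal (p x)) ≤
      ((1 + 2 * L ^ 2) * (2 * L ^ 2) ^ 2 * C : ℝ≥0) *
        ∫⁻ x, ENNReal.ofReal ((p x - 1) ^ 2) ∂m' := by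
  obtain ⟨k, hk, hk₁, hk₂, hkm⟩ := exists_density_of_comparable hL h₁ h₂
  have hL' : (1 : ℝ) ≤ L := by exact_mod_cast hL
  have hL0 : L ≠ 0 := by positivity
  have hk₀ : ∀ x, 0 ≤ k x := fun x => le_trans (by positivity) (hk₁ x)
  set t : ℝ≥0 := (2 * L ^ 2)⁻¹ with ht
  have htinv : t⁻¹ = 2 * L ^ 2 := by rw [ht, inv_inv]
  have htR : (t : ℝ) = (2 * (L : ℝ) ^ 2)⁻¹ := by rw [ht]; push_cast; rfl
  have ht0 : t ≠ 0 := by rw [ht]; positivity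
  have htR1 : (t : ℝ) ≤ 1 / 2 := by
    rw [htR, one_div]
    exact inv_anti₀ (by norm_num) (by nlinarith)
  have ht1 : t ≤ 1 := by
    rw [← NNReal.coe_le_coe]
    push_cast
    linarith
  set s : ℝ≥0 := 1 - t with hs
  have hst : s + t = 1 := tsub_add_cancel_of_le ht1
  have hsR : (s : ℝ) = 1 - t := by rw [hs, NNReal.coe_sub ht1]; rfl
  have hs0 : s ≠ 0 := by
    intro h0
    rw [h0] at hsR
    push_cast at hsR
    linarith
  set q : E → ℝ := fun x => 1 + (p x - 1) * k x / (2 * L) with hq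
  have hqm : Measurable q := by
    rw [hq]
    fun_prop
  have hq₁ : ∀ x, 1 / 2 ≤ q x := fun x => by
    have : k x / (2 * L) ≤ 1 / 2 := by
      rw [div_le_iff₀ (by linarith)]
      linarith [hk₂ x]
    have h0 : 0 ≤ k x / (2 * L) := div_nonneg (hk₀ x) (by linarith)
    simp only [hq]
    rw [mul_div_assoc]
    nlinarith [hp₀ x]
  have hq₂ : ∀ x, q x ≤ 1 + |M| := fun x => by
    have : k x / (2 * L) ≤ 1 := by
      rw [div_le_iff₀ (by linarith)]
      linarith [hk₂ x]
    have h0 : 0 ≤ k x / (2 * L) := div_nonneg (hk₀ x) (by linarith)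
    simp only [hq]
    rw [mul_div_assoc]
    nlinarith [hp₀ x, hM x, le_abs_self M, abs_nonneg M]
  set ρ := m'.withDensity (fun x => ENNReal.ofReal (p x)) with hρ
  have hρf : IsFiniteMeasure ρ := ⟨by rw [hmass]; exact measure_lt_top _ _⟩
  set σ := m.withDensity (fun x => ENNReal.ofReal (k x - (L : ℝ)⁻¹)) with hσ
  have hσ₀ : ∀ x, 0 ≤ k x - (L : ℝ)⁻¹ := fun x => sub_nonneg.2 (hk₁ x)
  have hm' : m' = ((L⁻¹ : ℝ≥0) : ℝ≥0∞) • m + σ := by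
    have : m = m.withDensity fun _ => ENNReal.ofReal 1 := by
      simp only [ofReal_one]
      exact withDensity_one.symm
    rw [show ((L⁻¹ : ℝ≥0) : ℝ≥0∞) • m =
      ((L⁻¹ : ℝ≥0) : ℝ≥0∞) • m.withDensity (fun _ => ENNReal.ofReal 1) from congrArg _ this]
    rw [hσ, ← withDensity_ofReal_const_mul m measurable_const, ← withDensity_ofReal_add m
      (by fun_prop) (fun x => by positivity) hσ₀, hkm]
    congr 1
    ext x
    push_cast
    ring_nf
  have hρt : (s : ℝ≥0∞) • m' + (t : ℝ≥0∞) • ρ =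
      ((L⁻¹ : ℝ≥0) : ℝ≥0∞) • (m.withDensity fun x => ENNReal.ofReal (q x)) + σ := by
    rw [hρ, hkm, withDensity_ofReal_withDensity_ofReal m hk hp hk₀,
      ← withDensity_ofReal_const_mul m hk, ← withDensity_ofReal_const_mul m (show Measurable fun x => k x * p x from hk.mul hp),
      ← withDensity_ofReal_const_mul m hqm, hσ,
      ← withDensity_ofReal_add m (by fun_prop) (fun x => mul_nonneg s.coe_nonneg (hk₀ x))
        (fun x => mul_nonneg t.coe_nonneg (mul_nonneg (hk₀ x) (hp₀ x))),
      ← withDensity_ofReal_add m (by fun_prop)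
        (fun x => mul_nonneg (NNReal.coe_nonneg _) (by linarith [hq₁ x])) hσ₀]
    congr 1
    ext x
    congr 1
    simp only [hq, hsR, htR]
    push_cast
    field_simp
    ring
  have hσf : IsFiniteMeasure σ := by
    refine ⟨lt_of_le_of_lt ?_ (measure_lt_top m' univ)⟩
    conv_rhs => rw [hm']
    rw [Measure.add_apply]
    exact le_add_self
  have hqmass : m.withDensity (fun x => ENNReal.ofReal (q x)) univ = m univ := by
    have h3 : ((s : ℝ≥0∞) • m' + (t : ℝ≥0∞) • ρ) univ = m' univ := by
      simp only [Measure.add_apply, Measure.smul_apply, smul_eq_mul, hmass]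
      rw [← add_mul, ← coe_add, hst, coe_one, one_mul]
    rw [hρt] at h3
    conv_rhs at h3 => rw [hm']
    simp only [Measure.add_apply, Measure.smul_apply, smul_eq_mul] at h3
    exact (ENNReal.mul_right_inj (by simpa using hL0) coe_ne_top).1
      ((ENNReal.add_left_inj (measure_ne_top σ _)).1 h3)
  have hW := W2sq_le_of_interpolate ht0 hs0 hst hfin
  have hX : W2sq m' ((s : ℝ≥0∞) • m' + (t : ℝ≥0∞) • ρ) ≤
      C * ∫⁻ x, ENNReal.ofReal ((p x - 1) ^ 2) ∂m' := by
    rw [hρt]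
    conv_lhs => rw [hm']
    refine (W2sq_add_le _ _ _ _).trans ?_
    rw [W2sq_self, add_zero]
    refine (W2sq_smul_le (by simpa using hL0) coe_ne_top _ _).trans ?_
    refine (mul_le_of_le_one_left bot_le ?_).trans ?_
    · exact_mod_cast inv_le_one_of_one_le₀ hL
    refine (h q hqm hq₁ ⟨_, hq₂⟩ hqmass).trans ?_
    rw [hkm, lintegral_withDensity_eq_lintegral_mul _ hk.ennreal_ofReal
      ((hp.sub_const 1).pow_const 2).ennreal_ofReal]
    gcongr with x
    rw [Pi.mul_apply, ← ofReal_mul (hk₀ x)]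
    refine ofReal_le_ofReal ?_
    simp only [hq]
    have h5 : (1 + (p x - 1) * k x / (2 * L) - 1) ^ 2 =
        k x / (2 * L) ^ 2 * (k x * (p x - 1) ^ 2) := by ring
    rw [h5]
    refine mul_le_of_le_one_left (mul_nonneg (hk₀ x) (sq_nonneg _)) ?_
    rw [div_le_one (by positivity)]
    nlinarith [hk₂ x]
  have h6 := hW.trans (mul_le_mul_right hX _)
  have ht2 : ((t⁻¹ : ℝ≥0) : ℝ≥0∞) ^ 2 * (t : ℝ≥0∞) ^ 2 = 1 := by
    rw [← mul_pow, ← coe_mul, inv_mul_cancel₀ ht0, coe_one, one_pow]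
  calc W2sq m' ρ = ((t⁻¹ : ℝ≥0) : ℝ≥0∞) ^ 2 * ((t : ℝ≥0∞) ^ 2 * W2sq m' ρ) := by
        rw [← mul_assoc, ht2, one_mul]
    _ ≤ _ := mul_le_mul_right h6 _
    _ = _ := by
      rw [htinv, ← mul_assoc, ← mul_assoc]
      congr 1
      push_cast
      ring

end Comparable

section Radial

lemma lipschitzWith_ratio_smul {V : Type*} [NormedAddCommGroup V] [NormedSpace ℝ V] {A B : V → ℝ}
    {K : ℝ≥0} (hA : ∀ z w, |A z - A w| ≤ K * ‖z - w‖) (hB : ∀ z w, |B z - B w| ≤ K * ‖z - w‖)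
    (hA₀ : ∀ z, 0 ≤ A z) (hA' : ∀ z, A z ≤ K * ‖z‖) (hB' : ∀ z, ‖z‖ ≤ K * B z) :
    LipschitzWith (2 * K ^ 2 + K ^ 4) fun z => (A z / B z) • z := by
  have hKB : ∀ z, z ≠ 0 → 0 < B z := fun z hz => by
    have h1 := hB' z
    have h2 : 0 < ‖z‖ := norm_pos_iff.2 hz
    by_contra h
    nlinarith [K.coe_nonneg]
  have hq : ∀ z, 0 ≤ A z / B z ∧ A z / B z ≤ (K : ℝ) ^ 2 := fun z => by
    by_cases hz : z = 0
    · have : A z = 0 := le_antisymm (by simpa [hz] using hA' z) (hA₀ z)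
      rw [this, zero_div]
      exact ⟨le_rfl, sq_nonneg _⟩
    · refine ⟨div_nonneg (hA₀ z) (hKB z hz).le, ?_⟩
      rw [div_le_iff₀ (hKB z hz)]
      nlinarith [hA' z, hB' z, K.coe_nonneg]
  refine LipschitzWith.of_dist_le_mul fun z w => ?_
  rw [dist_eq_norm, dist_eq_norm]
  push_cast
  set d := ‖z - w‖ with hd
  have hd0 : 0 ≤ d := norm_nonneg _
  have hfirst : ‖(A z / B z) • (z - w)‖ ≤ (K : ℝ) ^ 2 * d := by
    rw [norm_smul, Real.norm_eq_abs, abs_of_nonneg (hq z).1]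
    exact mul_le_mul_of_nonneg_right (hq z).2 hd0
  have hK2 : 0 ≤ (K : ℝ) ^ 2 * d := by positivity
  have hK4 : 0 ≤ (K : ℝ) ^ 4 * d := by positivity
  by_cases hw : w = 0
  · rw [hw, sub_zero] at hfirst
    rw [hw, smul_zero, sub_zero]
    linarith
  by_cases hz : z = 0
  · have h := mul_le_mul_of_nonneg_right (hq w).2 (norm_nonneg w)
    rw [hz, smul_zero, zero_sub, norm_neg, norm_smul, Real.norm_eq_abs, abs_of_nonneg (hq w).1]
    rw [hd, hz, zero_sub, norm_neg] at hK4 hK2 ⊢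
    linarith
  have hBz := hKB z hz
  have hBw := hKB w hw
  have hsplit : (A z / B z) • z - (A w / B w) • w =
      (A z / B z) • (z - w) + ((A z / B z * (B w - B z) + (A z - A w)) / B w) • w := by
    have : (A z / B z * (B w - B z) + (A z - A w)) / B w = A z / B z - A w / B w := by
      field_simp
      ring
    rw [this, smul_sub, sub_smul]
    abel
  have hsecond : ‖((A z / B z * (B w - B z) + (A z - A w)) / B w) • w‖ ≤
      ((K : ℝ) ^ 2 + (K : ℝ) ^ 4) * d := by
    rw [norm_smul, Real.norm_eq_abs, abs_div, abs_of_pos hBw]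
    have h1 : |A z / B z * (B w - B z) + (A z - A w)| ≤ ((K : ℝ) ^ 3 + K) * d := by
      refine (abs_add_le _ _).trans ?_
      have h2 : |A z / B z * (B w - B z)| ≤ (K : ℝ) ^ 2 * (K * d) := by
        rw [abs_mul, abs_of_nonneg (hq z).1, abs_sub_comm]
        exact mul_le_mul (hq z).2 (hB z w) (abs_nonneg _) (sq_nonneg _)
      have h3 : |A z - A w| ≤ K * d := hA z w
      calc _ ≤ (K : ℝ) ^ 2 * (K * d) + K * d := add_le_add h2 h3
        _ = _ := by ring
    rw [div_mul_eq_mul_div, div_le_iff₀ hBw]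
    calc _ ≤ ((K : ℝ) ^ 3 + K) * d * (K * B w) :=
          mul_le_mul h1 (hB' w) (norm_nonneg _) (by positivity)
      _ = _ := by ring
  rw [hsplit]
  refine (norm_add_le _ _).trans ((add_le_add hfirst hsecond).trans_eq ?_)
  ring

lemma volume_image_le {V : Type*} [NormedAddCommGroup V] [NormedSpace ℝ V]
    [FiniteDimensional ℝ V] [MeasurableSpace V] [BorelSpace V] (μ : Measure V)
    [μ.IsAddHaarMeasure] {K : ℝ≥0} {f : V → V} (hf : LipschitzWith K f) (s : Set V) :
    μ (f '' s) ≤ (K : ℝ≥0∞) ^ Module.finrank ℝ V * μ s := by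
  have h := hf.hausdorffMeasure_image_le (d := Module.finrank ℝ V) (Nat.cast_nonneg _) s
  rw [Measure.isAddLeftInvariant_eq_smul μ (μH[Module.finrank ℝ V] : Measure V)]
  simp only [Measure.smul_apply, ENNReal.smul_def, smul_eq_mul]
  rw [← mul_assoc, mul_comm (_ ^ _), mul_assoc]
  rw [rpow_natCast] at h
  gcongr

end Radial

section Model

/-- The weight `(2 (r - |x - x₀|)₊) ^ 2 dx`, the projection of Lebesgue measure on
`{(x, y) ∈ ℝⁿ × ℝ² | |x - x₀| + |y|_∞ ≤ r}`. -/
def coneWeight {n : ℕ} (x₀ : EuclideanSpace ℝ (Fin n)) (r : ℝ) :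
    Measure (EuclideanSpace ℝ (Fin n)) :=
  volume.withDensity fun x => ENNReal.ofReal (2 * (r - dist x x₀)) ^ 2

/-- The norm `|x|₂ + |y|_∞` on `ℝⁿ × ℝ²`. -/
def coneNorm {n : ℕ} (z : (Fin n → ℝ) × (ℝ × ℝ)) : ℝ :=
  ‖(WithLp.toLp 2 z.1 : EuclideanSpace ℝ (Fin n))‖ + ‖z.2‖

lemma norm_le_coneNorm {n : ℕ} (z : (Fin n → ℝ) × (ℝ × ℝ)) : ‖z‖ ≤ coneNorm z := by
  unfold coneNorm
  rw [Prod.norm_def]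
  have h : ‖z.1‖ ≤ ‖(WithLp.toLp 2 z.1 : EuclideanSpace ℝ (Fin n))‖ := by
    have := (PiLp.lipschitzWith_ofLp 2 (fun _ : Fin n => ℝ)).dist_le_mul (WithLp.toLp 2 z.1) 0
    simpa using this
  have h' := norm_nonneg z.1
  have h'' := norm_nonneg z.2
  exact max_le (by linarith) (by linarith)

lemma exists_norm_toLp_le (n : ℕ) : ∃ K : ℝ≥0, 1 ≤ K ∧
    LipschitzWith K (WithLp.toLp 2 : (Fin n → ℝ) → EuclideanSpace ℝ (Fin n)) :=
  ⟨max 1 _, le_max_left _ _, (PiLp.lipschitzWith_toLp 2 (fun _ : Fin n => ℝ)).weaken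
    (le_max_right _ _)⟩

lemma abs_coneNorm_sub_le {n : ℕ} {K : ℝ≥0}
    (hK : LipschitzWith K (WithLp.toLp 2 : (Fin n → ℝ) → EuclideanSpace ℝ (Fin n)))
    (z w : (Fin n → ℝ) × (ℝ × ℝ)) : |coneNorm z - coneNorm w| ≤ (K + 1 : ℝ≥0) * ‖z - w‖ := by
  have h₁ : |‖(WithLp.toLp 2 z.1 : EuclideanSpace ℝ (Fin n))‖ -
      ‖(WithLp.toLp 2 w.1 : EuclideanSpace ℝ (Fin n))‖| ≤ K * ‖z - w‖ := by
    refine (abs_norm_sub_norm_le _ _).trans ?_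
    have := hK.dist_le_mul z.1 w.1
    rw [dist_eq_norm, dist_eq_norm] at this
    exact this.trans (mul_le_mul_of_nonneg_left (norm_fst_le (z - w)) K.coe_nonneg)
  have h₂ : |‖z.2‖ - ‖w.2‖| ≤ ‖z - w‖ :=
    (abs_norm_sub_norm_le _ _).trans (norm_snd_le (z - w))
  unfold coneNorm
  push_cast
  rw [abs_le] at *
  constructor <;> linarith [h₁.1, h₁.2, h₂.1, h₂.2]

lemma coneNorm_smul {n : ℕ} {c : ℝ} (hc : 0 ≤ c) (z : (Fin n → ℝ) × (ℝ × ℝ)) :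
    coneNorm (c • z) = c * coneNorm z := by
  unfold coneNorm
  rw [Prod.smul_fst, Prod.smul_snd, WithLp.toLp_smul, norm_smul, norm_smul, Real.norm_eq_abs,
    abs_of_nonneg hc, mul_add]

lemma continuous_coneNorm {n : ℕ} :
    Continuous (coneNorm : (Fin n → ℝ) × (ℝ × ℝ) → ℝ) := by
  obtain ⟨K, -, hK⟩ := exists_norm_toLp_le n
  refine LipschitzWith.continuous (K := K + 1) (LipschitzWith.of_dist_le_mul fun z w => ?_)
  rw [Real.dist_eq, dist_eq_norm]
  exact abs_coneNorm_sub_le hK z w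

lemma map_restrict_coneNorm {n : ℕ} (x₀ : EuclideanSpace ℝ (Fin n)) (r : ℝ) :
    ((volume : Measure ((Fin n → ℝ) × (ℝ × ℝ))).restrict {z | coneNorm z ≤ r}).map
      (fun z => x₀ + WithLp.toLp 2 z.1) = coneWeight x₀ r := by
  have hLp : Continuous (WithLp.toLp 2 : (Fin n → ℝ) → EuclideanSpace ℝ (Fin n)) := by
    obtain ⟨K, -, hK⟩ := exists_norm_toLp_le n
    exact hK.continuous
  have hm : Measurable fun z : (Fin n → ℝ) × (ℝ × ℝ) =>
      x₀ + (WithLp.toLp 2 z.1 : EuclideanSpace ℝ (Fin n)) :=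
    (continuous_const.add (hLp.comp continuous_fst)).measurable
  have hS : MeasurableSet {z : (Fin n → ℝ) × (ℝ × ℝ) | coneNorm z ≤ r} :=
    (isClosed_le continuous_coneNorm continuous_const).measurableSet
  have hden : Measurable fun x => ENNReal.ofReal (2 * (r - dist x x₀)) ^ 2 := by fun_prop
  have hmp : MeasurePreserving
      (fun x : Fin n → ℝ => x₀ + (WithLp.toLp 2 x : EuclideanSpace ℝ (Fin n))) volume volume :=
    (measurePreserving_add_left volume x₀).comp (PiLp.volume_preserving_toLp (Fin n))
  ext A hA
  rw [Measure.map_apply hm hA, Measure.restrict_apply (hm hA), coneWeight, withDensity_apply _ hA,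
    ← lintegral_indicator hA, ← hmp.lintegral_comp (hden.indicator hA), Measure.volume_eq_prod,
    Measure.prod_apply ((hm hA).inter hS)]
  refine lintegral_congr fun x => ?_
  by_cases hx : x₀ + WithLp.toLp 2 x ∈ A
  · rw [indicator_of_mem hx]
    have : Prod.mk x ⁻¹' ((fun z : (Fin n → ℝ) × (ℝ × ℝ) => x₀ + WithLp.toLp 2 z.1) ⁻¹' A ∩
        {z | coneNorm z ≤ r}) =
        closedBall (0 : ℝ × ℝ) (r - ‖(WithLp.toLp 2 x : EuclideanSpace ℝ (Fin n))‖) := by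
      ext y
      simp only [mem_preimage, mem_inter_iff, hx, true_and, mem_ofPred_eq, mem_closedBall_zero_iff,
        coneNorm]
      constructor <;> intro h <;> linarith
    rw [this, dist_eq_norm, add_sub_cancel_left, show (0 : ℝ × ℝ) = (0, 0) from rfl,
      ← closedBall_prod_same, Measure.volume_eq_prod, Measure.prod_prod, Real.volume_closedBall,
      sq]
  · rw [indicator_of_notMem hx]
    refine measure_mono_null (fun y hy => ?_) (measure_empty (μ := volume))
    exact hx hy.1

lemma isAddHaarMeasure_volume_prod (n : ℕ) :
    (volume : Measure ((Fin n → ℝ) × (ℝ × ℝ))).IsAddHaarMeasure := by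
  have h : (volume : Measure (ℝ × ℝ)).IsAddHaarMeasure :=
    Measure.prod.instIsAddHaarMeasure volume volume
  have h' : (volume : Measure (Fin n → ℝ)).IsAddHaarMeasure := inferInstance
  exact Measure.prod.instIsAddHaarMeasure volume volume

lemma exists_model (n : ℕ) {R : ℝ≥0} (hR : 1 ≤ R) :
    ∃ C L : ℝ≥0, 1 ≤ L ∧ ∀ (x₀ : EuclideanSpace ℝ (Fin n)) (r : ℝ), (R : ℝ)⁻¹ ≤ r → r ≤ R →
      ∃ m : Measure (EuclideanSpace ℝ (Fin n)), IsFiniteMeasure m ∧ TransportPoincare m C ∧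
        m ≤ (L : ℝ≥0∞) • coneWeight x₀ r ∧ coneWeight x₀ r ≤ (L : ℝ≥0∞) • m := by
  obtain ⟨C, hC⟩ := exists_transportPoincare_cube n
  obtain ⟨K, hK1, hK⟩ := exists_norm_toLp_le n
  have hHaar := isAddHaarMeasure_volume_prod n
  have hball : ∀ z : (Fin n → ℝ) × (ℝ × ℝ), z ∈ closedBall 0 (1 / 2) ↔ ‖z‖ ≤ 1 / 2 :=
    fun z => mem_closedBall_zero_iff
  set X := (Fin n → ℝ) × (ℝ × ℝ) with hX
  set K₁ : ℝ≥0 := 2 * (K + 1) ^ 2 + (K + 1) ^ 4 with hK₁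
  have hR' : (1 : ℝ) ≤ R := by exact_mod_cast hR
  have hnorm : ∀ z w : X, |‖z‖ - ‖w‖| ≤ (K + 1 : ℝ≥0) * ‖z - w‖ := fun z w => by
    refine (abs_norm_sub_norm_le z w).trans (le_mul_of_one_le_left (norm_nonneg _) ?_)
    push_cast
    linarith [K.coe_nonneg]
  have hle1 : ∀ z : X, ‖z‖ ≤ (K + 1 : ℝ≥0) * ‖z‖ := fun z => by
    refine le_mul_of_one_le_left (norm_nonneg _) ?_
    push_cast
    linarith [K.coe_nonneg]
  have hle2 : ∀ z : X, ‖z‖ ≤ (K + 1 : ℝ≥0) * coneNorm z := fun z => by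
    refine (norm_le_coneNorm z).trans (le_mul_of_one_le_left
      ((norm_nonneg z).trans (norm_le_coneNorm z)) ?_)
    push_cast
    linarith [K.coe_nonneg]
  have hle3 : ∀ z : X, coneNorm z ≤ (K + 1 : ℝ≥0) * ‖z‖ := fun z => by
    have h := abs_coneNorm_sub_le hK z 0
    have h0 : coneNorm (0 : X) = 0 := by simp [coneNorm]
    rw [h0, sub_zero, sub_zero] at h
    exact (le_abs_self _).trans h
  have hF := lipschitzWith_ratio_smul hnorm (abs_coneNorm_sub_le hK) norm_nonneg hle1 hle2
  have hG := lipschitzWith_ratio_smul (abs_coneNorm_sub_le hK) hnorm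
    (fun z => (norm_nonneg z).trans (norm_le_coneNorm z)) hle3 hle1
  set d := Module.finrank ℝ X with hd
  set K₂ : ℝ≥0 := 2 * R * K₁ with hK₂
  have hK₂1 : 1 ≤ K₂ := by
    rw [hK₂, hK₁]
    have h1 : 1 ≤ (K + 1) := le_add_self
    have h2 : 1 ≤ 2 * R := by
      rw [two_mul]
      exact hR.trans le_self_add
    have h3 : 1 ≤ (K + 1) ^ 4 := one_le_pow₀ h1
    exact one_le_mul h2 (h3.trans le_add_self)
  refine ⟨(K * K₂) ^ 2 * C, K₂ ^ d, one_le_pow₀ hK₂1, fun x₀ r hr₁ hr₂ => ?_⟩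
  have hr0 : 0 < r := lt_of_lt_of_le (by positivity) hr₁
  set F : X → X := fun z => (2 * r) • ((‖z‖ / coneNorm z) • z) with hFdef
  set G : X → X := fun z => (2 * r)⁻¹ • ((coneNorm z / ‖z‖) • z) with hGdef
  have hFL : LipschitzWith K₂ F := by
    refine ((lipschitzWith_smul (2 * r)).comp hF).weaken ?_
    rw [hK₂]
    refine mul_le_mul_left ?_ _
    rw [← NNReal.coe_le_coe, coe_nnnorm, Real.norm_eq_abs, abs_of_pos (by linarith)]
    push_cast
    linarith
  have hGL : LipschitzWith K₂ G := by
    refine ((lipschitzWith_smul (2 * r)⁻¹).comp hG).weaken ?_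
    rw [hK₂]
    refine mul_le_mul_left ?_ _
    rw [← NNReal.coe_le_coe, coe_nnnorm, Real.norm_eq_abs, abs_of_pos (by positivity)]
    push_cast
    rw [mul_inv]
    have : r⁻¹ ≤ R := by
      have h := inv_anti₀ (by positivity) hr₁
      rwa [inv_inv] at h
    have h' : 0 < r⁻¹ := inv_pos.2 hr0
    linarith
  have hpos : ∀ z : X, z ≠ 0 → 0 < ‖z‖ ∧ 0 < coneNorm z := fun z hz =>
    ⟨norm_pos_iff.2 hz, (norm_pos_iff.2 hz).trans_le (norm_le_coneNorm z)⟩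
  have hF0 : ∀ z : X, z ≠ 0 → ‖F z‖ = 2 * r * (‖z‖ / coneNorm z * ‖z‖) ∧
      coneNorm (F z) = 2 * r * ‖z‖ := fun z hz => by
    obtain ⟨h1, h2⟩ := hpos z hz
    have h3 : 0 ≤ ‖z‖ / coneNorm z := by positivity
    rw [hFdef]
    constructor
    · simp only
      rw [norm_smul, norm_smul, Real.norm_eq_abs, Real.norm_eq_abs, abs_of_nonneg h3,
        abs_of_pos (by linarith)]
    · simp only
      rw [coneNorm_smul (by linarith), coneNorm_smul h3]
      field_simp
  have hG0 : ∀ z : X, z ≠ 0 → coneNorm (G z) = (2 * r)⁻¹ * (coneNorm z / ‖z‖ * coneNorm z) ∧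
      ‖G z‖ = (2 * r)⁻¹ * coneNorm z := fun z hz => by
    obtain ⟨h1, h2⟩ := hpos z hz
    have h3 : 0 ≤ coneNorm z / ‖z‖ := by positivity
    rw [hGdef]
    constructor
    · simp only
      rw [coneNorm_smul (by positivity), coneNorm_smul h3]
    · simp only
      rw [norm_smul, norm_smul, Real.norm_eq_abs, Real.norm_eq_abs, abs_of_nonneg h3,
        abs_of_pos (by positivity)]
      field_simp
  have hGF : ∀ z, G (F z) = z := fun z => by
    by_cases hz : z = 0
    · simp [hFdef, hGdef, hz]
    obtain ⟨h1, h2⟩ := hpos z hz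
    obtain ⟨h3, h4⟩ := hF0 z hz
    rw [show G (F z) = (2 * r)⁻¹ • ((coneNorm (F z) / ‖F z‖) • F z) from rfl, h3, h4]
    simp only [hFdef, smul_smul]
    convert one_smul ℝ z using 2
    field_simp
  have hFG : ∀ z, F (G z) = z := fun z => by
    by_cases hz : z = 0
    · simp [hFdef, hGdef, hz]
    obtain ⟨h1, h2⟩ := hpos z hz
    obtain ⟨h3, h4⟩ := hG0 z hz
    rw [show F (G z) = (2 * r) • ((‖G z‖ / coneNorm (G z)) • G z) from rfl, h3, h4]
    simp only [hGdef, smul_smul]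
    convert one_smul ℝ z using 2
    field_simp
  have hFQ : ∀ z ∈ closedBall (0 : X) (1 / 2), coneNorm (F z) ≤ r := fun z hz => by
    replace hz := (hball z).1 hz
    by_cases h0 : z = 0
    · simpa [hFdef, h0, coneNorm] using hr0.le
    rw [(hF0 z h0).2]
    nlinarith
  have hGQ : ∀ z, coneNorm z ≤ r → G z ∈ closedBall (0 : X) (1 / 2) := fun z hz => by
    refine (hball _).2 ?_
    by_cases h0 : z = 0
    · simp [hGdef, h0]
    rw [(hG0 z h0).2, inv_mul_le_iff₀ (by linarith)]
    linarith
  set Q := (volume : Measure X).restrict (closedBall 0 (1 / 2)) with hQ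
  set S := (volume : Measure X).restrict {z | coneNorm z ≤ r} with hS
  have hSm : MeasurableSet {z : X | coneNorm z ≤ r} :=
    (isClosed_le continuous_coneNorm continuous_const).measurableSet
  have hFm : Measurable F := hFL.continuous.measurable
  have hle₁ : Q.map F ≤ ((K₂ ^ d : ℝ≥0) : ℝ≥0∞) • S := by
    refine Measure.le_iff.2 fun A hA => ?_
    rw [Measure.map_apply hFm hA, hQ, Measure.restrict_apply (hFm hA), Measure.smul_apply, hS,
      Measure.restrict_apply hA, smul_eq_mul]
    refine (measure_mono fun z hz => ?_).trans
      ((volume_image_le volume hGL (A ∩ {z | coneNorm z ≤ r})).trans_eq ?_)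
    · exact ⟨F z, ⟨hz.1, hFQ z hz.2⟩, hGF z⟩
    · push_cast
      rfl
  have hle₂ : S ≤ ((K₂ ^ d : ℝ≥0) : ℝ≥0∞) • Q.map F := by
    refine Measure.le_iff.2 fun A hA => ?_
    rw [Measure.smul_apply, Measure.map_apply hFm hA, hQ, Measure.restrict_apply (hFm hA), hS,
      Measure.restrict_apply hA, smul_eq_mul]
    refine (measure_mono fun z hz => ?_).trans
      ((volume_image_le volume hFL (F ⁻¹' A ∩ closedBall 0 (1 / 2))).trans_eq ?_)
    · refine ⟨G z, ⟨?_, hGQ z hz.2⟩, hFG z⟩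
      rw [mem_preimage, hFG]
      exact hz.1
    · push_cast
      rfl
  set P : X → EuclideanSpace ℝ (Fin n) := fun z => x₀ + WithLp.toLp 2 z.1 with hP
  have hPL : LipschitzWith K P := by
    refine LipschitzWith.of_dist_le_mul fun z w => ?_
    rw [hP, dist_add_left]
    exact (hK.dist_le_mul z.1 w.1).trans (mul_le_mul_of_nonneg_left (le_max_left _ _) K.coe_nonneg)
  have hPm : Measurable P := hPL.continuous.measurable
  have hPF : LipschitzWith (K * K₂) (P ∘ F) := hPL.comp hFL
  have hQf : IsFiniteMeasure Q := ⟨by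
    rw [hQ, Measure.restrict_apply_univ]
    exact (isCompact_closedBall _ _).measure_lt_top⟩
  have hcone : coneWeight x₀ r = S.map P := (map_restrict_coneNorm x₀ r).symm
  have hKK : K * K₂ ≠ 0 := mul_ne_zero (zero_lt_one.trans_le hK1).ne' (zero_lt_one.trans_le hK₂1).ne'
  refine ⟨Q.map (P ∘ F), inferInstance, hC.map hKK hPF, ?_, ?_⟩
  · rw [hcone, ← Measure.map_map hPm hFm, ← Measure.map_smul]
    exact Measure.map_mono hle₁ hPm
  · rw [hcone, ← Measure.map_map hPm hFm, ← Measure.map_smul]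
    exact Measure.map_mono hle₂ hPm

end Model

section Bump

variable {n : ℕ} {c₂ r : ℝ} {x₀ : EuclideanSpace ℝ (Fin n)} {φ : EuclideanSpace ℝ (Fin n) → ℝ}

/-- Along a ray from the centre, a radial function decreases at the rate given by the gradient
bound. -/
lemma abs_ray_sub_le (hφL : ∃ K : ℝ≥0, LipschitzWith K φ)
    (hrad : ∀ y z, dist y x₀ = dist z x₀ → φ y = φ z)
    (hgrad : ∀ y ∈ closedBall x₀ r, DifferentiableAt ℝ φ y →
      ‖fderiv ℝ φ y‖ ≤ c₂ * (r - dist y x₀)) (hc₂ : 0 < c₂)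
    {e : EuclideanSpace ℝ (Fin n)} (he : ‖e‖ = 1) {s u : ℝ} (hs : 0 ≤ s) (hsu : s ≤ u)
    (hu : u ≤ r) : |φ (x₀ + u • e) - φ (x₀ + s • e)| ≤ c₂ * (r - s) * (u - s) := by
  obtain ⟨K, hK⟩ := hφL
  set g : ℝ → ℝ := fun t => φ (x₀ + t • e) with hg
  have hgL : LipschitzWith K g := by
    refine LipschitzWith.of_dist_le_mul fun t t' => ?_
    refine (hK.dist_le_mul _ _).trans_eq ?_
    rw [dist_add_left, dist_eq_norm, ← sub_smul, norm_smul, he, mul_one, dist_eq_norm]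
  have hray : ∀ t : ℝ, 0 ≤ t → dist (x₀ + t • e) x₀ = t := fun t ht => by
    rw [dist_eq_norm, add_sub_cancel_left, norm_smul, he, mul_one, Real.norm_eq_abs,
      abs_of_nonneg ht]
  have hφg : φ = fun z => g ‖z - x₀‖ := by
    ext z
    refine hrad _ _ ?_
    rw [hray _ (norm_nonneg _), dist_eq_norm]
  rw [← (hgL.lipschitzOnWith (s := uIcc s u)).absolutelyContinuousOnInterval.integral_deriv_eq_sub,
    ← Real.norm_eq_abs]
  refine (intervalIntegral.norm_integral_le_of_norm_le_const (C := c₂ * (r - s))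
    fun t ht => ?_).trans_eq ?_
  · rw [uIoc_of_le hsu] at ht
    have ht0 : 0 < t := hs.trans_lt ht.1
    by_cases hd : DifferentiableAt ℝ g t
    · have hne : x₀ + t • e - x₀ ≠ 0 := by
        rw [add_sub_cancel_left]
        refine smul_ne_zero ht0.ne' fun h => ?_
        rw [h, norm_zero] at he
        exact zero_ne_one he
      have hnt : ‖x₀ + t • e - x₀‖ = t := by
        rw [← dist_eq_norm]
        exact hray t ht0.le
      have hφd : DifferentiableAt ℝ φ (x₀ + t • e) := by
        rw [hφg]
        refine DifferentiableAt.comp (g := g) (f := fun z => ‖z - x₀‖) _ ?_ ?_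
        · rwa [hnt]
        · exact (differentiableAt_id.sub_const x₀).norm ℝ hne
      have hline : HasDerivAt (fun t : ℝ => x₀ + t • e) e t := by
        have := ((hasDerivAt_id t).smul_const e).const_add x₀
        simpa using this
      have hderiv : deriv g t = fderiv ℝ φ (x₀ + t • e) e :=
        (hφd.hasFDerivAt.comp_hasDerivAt t hline).deriv
      have hmem : x₀ + t • e ∈ closedBall x₀ r := by
        rw [mem_closedBall, hray t ht0.le]
        exact ht.2.trans hu
      have hb := hgrad _ hmem hφd
      rw [hray t ht0.le] at hb
      rw [hderiv]
      refine (ContinuousLinearMap.le_opNorm _ _).trans ?_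
      rw [he, mul_one]
      refine hb.trans (mul_le_mul_of_nonneg_left ?_ hc₂.le)
      linarith [ht.1]
    · rw [deriv_zero_of_not_differentiableAt hd, norm_zero]
      exact mul_nonneg hc₂.le (by linarith)
  · rw [abs_of_nonneg (by linarith)]

lemma abs_bump_sub_le (hc₂ : 0 < c₂) (hφ : ∀ y, φ y ∈ Icc (0 : ℝ) 1)
    (hφL : ∃ K : ℝ≥0, LipschitzWith K φ)
    (hrad : ∀ y z, dist y x₀ = dist z x₀ → φ y = φ z)
    (hout : ∀ y, y ∉ closedBall x₀ r → φ y = 0)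
    (hquad : ∀ y ∈ closedBall x₀ r,
      c₂⁻¹ * (r - dist y x₀) ^ 2 ≤ φ y ∧ φ y ≤ c₂ * (r - dist y x₀) ^ 2)
    (hgrad : ∀ y ∈ closedBall x₀ r, DifferentiableAt ℝ φ y →
      ‖fderiv ℝ φ y‖ ≤ c₂ * (r - dist y x₀)) (x y : EuclideanSpace ℝ (Fin n)) :
    |φ x - φ y| ≤ c₂ * max 0 (max (r - dist x x₀) (r - dist y x₀)) * dist x y := by
  wlog h : dist x x₀ ≤ dist y x₀ generalizing x y
  · rw [abs_sub_comm, max_comm (r - dist x x₀), dist_comm x y]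
    exact this y x (le_of_not_ge h)
  rw [max_eq_left (show r - dist y x₀ ≤ r - dist x x₀ by linarith)]
  have htri : dist y x₀ - dist x x₀ ≤ dist x y := by
    have := dist_triangle y x x₀
    rw [dist_comm y x] at this
    linarith
  by_cases hxy : x = y
  · simp [hxy]
  by_cases hx : dist x x₀ ≤ r
  · rw [max_eq_right (sub_nonneg.2 hx)]
    refine le_trans ?_ (mul_le_mul_of_nonneg_left htri
      (mul_nonneg hc₂.le (sub_nonneg.2 hx)))
    by_cases hy : dist y x₀ ≤ r
    · set e : EuclideanSpace ℝ (Fin n) := (‖x - y‖)⁻¹ • (x - y) with he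
      have hne : ‖x - y‖ ≠ 0 := norm_ne_zero_iff.2 (sub_ne_zero.2 hxy)
      have he1 : ‖e‖ = 1 := by
        rw [he, norm_smul, norm_inv, norm_norm, inv_mul_cancel₀ hne]
      have hray : ∀ z, φ z = φ (x₀ + dist z x₀ • e) := fun z => by
        refine hrad _ _ ?_
        rw [dist_eq_norm (x₀ + _), add_sub_cancel_left, norm_smul, he1, mul_one, Real.norm_eq_abs,
          abs_of_nonneg dist_nonneg]
      rw [abs_sub_comm, hray x, hray y]
      exact abs_ray_sub_le hφL hrad hgrad hc₂ he1 dist_nonneg h hy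
    · rw [hout y (by simpa using hy), sub_zero, abs_of_nonneg (hφ x).1]
      refine (hquad x hx).2.trans ?_
      rw [sq, ← mul_assoc]
      refine mul_le_mul_of_nonneg_left ?_ (mul_nonneg hc₂.le (sub_nonneg.2 hx))
      linarith [not_le.1 hy]
  · have hy : ¬ dist y x₀ ≤ r := fun hy => hx (h.trans hy)
    rw [hout x (by simpa using hx), hout y (by simpa using hy), sub_zero, abs_zero]
    positivity

end Bump

section Localize

/-- The properties of a bump `φ` that vanishes quadratically at the boundary of its support, in
terms of the distance `D` to the complement of the support. -/
structure IsQuadraticBump {E : Type*} [MetricSpace E] [MeasurableSpace E] (c : ℝ) (D φ : E → ℝ) :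
    Prop where
  one_le : 1 ≤ c
  measurable_dist : Measurable D
  measurable : Measurable φ
  dist_nonneg : ∀ x, 0 ≤ D x
  dist_le : ∀ x y, D y ≤ D x + dist x y
  dist_sq_le : ∀ x, D x ^ 2 ≤ c
  nonneg : ∀ x, 0 ≤ φ x
  le_one : ∀ x, φ x ≤ 1
  sq_le : ∀ x, D x ^ 2 ≤ c * φ x
  le_sq : ∀ x, φ x ≤ c * D x ^ 2
  abs_sub_le : ∀ x y, |φ x - φ y| ≤ c * max (D x) (D y) * dist x y
  diam_le : ∀ x y, φ x ≠ 0 → φ y ≠ 0 → dist x y ^ 2 ≤ 4 * c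

/-- The part `φ(y)` of the mass at `y` that comes from points `x` close to `y` relative to
`D x`. -/
def nearPart {E : Type*} [MetricSpace E] (D φ : E → ℝ) (z : E × E) : ℝ :=
  if 2 * dist z.1 z.2 ≤ D z.1 then φ z.2 else 0

namespace IsQuadraticBump

variable {E : Type*} [MetricSpace E] [MeasurableSpace E] {c : ℝ} {D φ : E → ℝ}

lemma nearPart_nonneg (h : IsQuadraticBump c D φ) (z : E × E) : 0 ≤ nearPart D φ z := by
  unfold nearPart
  split_ifs
  · exact h.nonneg _
  · exact le_rfl

lemma nearPart_le (h : IsQuadraticBump c D φ) (z : E × E) : nearPart D φ z ≤ φ z.2 := by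
  unfold nearPart
  split_ifs
  · exact le_rfl
  · exact h.nonneg _

lemma nearPart_le_mul (h : IsQuadraticBump c D φ) (z : E × E) :
    nearPart D φ z ≤ 3 * c ^ 2 * φ z.1 := by
  have hc := h.one_le
  unfold nearPart
  split_ifs with hz
  · have h1 := h.le_sq z.2
    have h2 := h.dist_le z.1 z.2
    have h3 := h.sq_le z.1
    have h4 := h.dist_nonneg z.2
    have h5 := h.dist_nonneg z.1
    have h6 : D z.2 ^ 2 ≤ 3 * D z.1 ^ 2 := by nlinarith
    calc φ z.2 ≤ c * (3 * D z.1 ^ 2) := h1.trans (mul_le_mul_of_nonneg_left h6 (by linarith))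
      _ ≤ c * (3 * (c * φ z.1)) := by gcongr
      _ = _ := by ring
  · have := h.nonneg z.1
    positivity

lemma sub_nearPart_le (h : IsQuadraticBump c D φ) (z : E × E) :
    φ z.2 - nearPart D φ z ≤ 9 * c * dist z.1 z.2 ^ 2 := by
  have hc := h.one_le
  unfold nearPart
  split_ifs with hz
  · rw [sub_self]
    positivity
  · have h1 := h.le_sq z.2
    have h2 := h.dist_le z.1 z.2
    have h4 := h.dist_nonneg z.2
    have h6 : D z.2 ^ 2 ≤ 9 * dist z.1 z.2 ^ 2 := by nlinarith
    nlinarith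

lemma sq_nearPart_sub_le (h : IsQuadraticBump c D φ) (z : E × E) :
    (nearPart D φ z - φ z.1) ^ 2 ≤ 4 * c ^ 3 * φ z.1 * dist z.1 z.2 ^ 2 := by
  have hc := h.one_le
  have hD := h.dist_nonneg z.1
  have hd : 0 ≤ dist z.1 z.2 := _root_.dist_nonneg
  have key : |nearPart D φ z - φ z.1| ≤ 2 * c * D z.1 * dist z.1 z.2 := by
    unfold nearPart
    split_ifs with hz
    · rw [abs_sub_comm]
      refine (h.abs_sub_le z.1 z.2).trans ?_
      have h2 := h.dist_le z.1 z.2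
      have h3 : max (D z.1) (D z.2) ≤ 2 * D z.1 := max_le (by linarith) (by linarith)
      have h4 : c * max (D z.1) (D z.2) ≤ 2 * c * D z.1 := by nlinarith
      exact mul_le_mul_of_nonneg_right h4 hd
    · rw [zero_sub, abs_neg, abs_of_nonneg (h.nonneg _)]
      refine (h.le_sq z.1).trans ?_
      have h4 : D z.1 * D z.1 ≤ D z.1 * (2 * dist z.1 z.2) :=
        mul_le_mul_of_nonneg_left (le_of_not_ge hz) hD
      nlinarith
  calc (nearPart D φ z - φ z.1) ^ 2 ≤ (2 * c * D z.1 * dist z.1 z.2) ^ 2 := by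
        rw [← sq_abs]
        gcongr
    _ = 4 * c ^ 2 * D z.1 ^ 2 * dist z.1 z.2 ^ 2 := by ring
    _ ≤ 4 * c ^ 2 * (c * φ z.1) * dist z.1 z.2 ^ 2 := by
        gcongr
        exact h.sq_le _
    _ = _ := by ring

lemma sq_sub_le (h : IsQuadraticBump c D φ) (x y : E) :
    (φ x - φ y) ^ 2 ≤ c ^ 3 * dist x y ^ 2 := by
  have hc := h.one_le
  have hm : max (D x) (D y) ^ 2 ≤ c := by
    rcases max_choice (D x) (D y) with h1 | h1 <;> rw [h1] <;> exact h.dist_sq_le _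
  have h2 := h.abs_sub_le x y
  calc (φ x - φ y) ^ 2 ≤ (c * max (D x) (D y) * dist x y) ^ 2 := by
        rw [← sq_abs]
        gcongr
    _ = c ^ 2 * max (D x) (D y) ^ 2 * dist x y ^ 2 := by ring
    _ ≤ c ^ 2 * c * dist x y ^ 2 := by gcongr
    _ = _ := by ring

lemma integrable (h : IsQuadraticBump c D φ) (μ : Measure E) [IsFiniteMeasure μ] :
    Integrable φ μ :=
  Integrable.of_bound h.measurable.aestronglyMeasurable 1 (.of_forall fun x => by
    rw [Real.norm_eq_abs, abs_of_nonneg (h.nonneg x)]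
    exact h.le_one x)

lemma lintegral_ofReal_mul_dist_sq (π : Measure (E × E)) {a : ℝ} (ha : 0 ≤ a) :
    ∫⁻ z, ENNReal.ofReal (a * dist z.1 z.2 ^ 2) ∂π =
      ENNReal.ofReal a * ∫⁻ z, edist z.1 z.2 ^ 2 ∂π := by
  rw [← lintegral_const_mul' _ _ ofReal_ne_top]
  refine lintegral_congr fun z => ?_
  rw [ofReal_mul ha, edist_dist, ofReal_pow _root_.dist_nonneg]

variable [BorelSpace E] [SecondCountableTopology E]

lemma measurable_nearPart (h : IsQuadraticBump c D φ) : Measurable (nearPart D φ) := by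
  unfold nearPart
  refine Measurable.ite (measurableSet_le ?_ ?_) (h.measurable.comp measurable_snd)
    measurable_const
  · fun_prop
  · exact h.measurable_dist.comp measurable_fst

omit [BorelSpace E] [SecondCountableTopology E] in
lemma ofReal_integral (h : IsQuadraticBump c D φ) (μ : Measure E) [IsFiniteMeasure μ] :
    ENNReal.ofReal (∫ x, φ x ∂μ) = ∫⁻ x, ENNReal.ofReal (φ x) ∂μ :=
  ofReal_integral_eq_lintegral_ofReal (h.integrable μ) (.of_forall h.nonneg)

omit [BorelSpace E] [SecondCountableTopology E] in
lemma ofReal_sq_integral_sub_le (h : IsQuadraticBump c D φ) (π : Measure (E × E))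
    [IsProbabilityMeasure π] :
    ENNReal.ofReal ((∫ x, φ x ∂(π.map Prod.fst) - ∫ y, φ y ∂(π.map Prod.snd)) ^ 2) ≤
      ENNReal.ofReal (c ^ 3) * ∫⁻ z, edist z.1 z.2 ^ 2 ∂π := by
  have hc := h.one_le
  have h1 : Integrable (fun z : E × E => φ z.1) π :=
    (h.integrable (π.map Prod.fst)).comp_measurable measurable_fst
  have h2 : Integrable (fun z : E × E => φ z.2) π :=
    (h.integrable (π.map Prod.snd)).comp_measurable measurable_snd
  rw [integral_map measurable_fst.aemeasurable h.measurable.aestronglyMeasurable,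
    integral_map measurable_snd.aemeasurable h.measurable.aestronglyMeasurable,
    ← integral_sub h1 h2]
  refine (ofReal_sq_integral_le π (M := 1) ((h.measurable.comp measurable_fst).sub
    (h.measurable.comp measurable_snd)) fun z => ?_).trans ?_
  · rw [abs_le]
    have := h.nonneg z.1
    have := h.nonneg z.2
    have := h.le_one z.1
    have := h.le_one z.2
    constructor <;> simp <;> linarith
  · rw [← lintegral_ofReal_mul_dist_sq π (by positivity)]
    exact lintegral_mono fun z => ofReal_le_ofReal (h.sq_sub_le z.1 z.2)

lemma W2sq_le_diam (h : IsQuadraticBump c D φ) {α β : Measure E} [IsFiniteMeasure α]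
    [IsFiniteMeasure β] (hm : α univ = β univ) (hα : α {x | φ x = 0} = 0)
    (hβ : β {x | φ x = 0} = 0) : W2sq α β ≤ ENNReal.ofReal (4 * c) * α univ := by
  have hc := h.one_le
  have hs : {x | φ x ≠ 0}ᶜ = {x | φ x = 0} := by
    ext x
    simp
  have := W2sq_le_of_bounded (D := ENNReal.ofReal (Real.sqrt (4 * c))) hm (s := {x | φ x ≠ 0})
    (by rwa [hs]) (by rwa [hs]) fun x hx y hy => by
      rw [edist_dist]
      exact ofReal_le_ofReal (Real.le_sqrt_of_sq_le (h.diam_le x y hx hy))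
  rwa [← ofReal_pow (Real.sqrt_nonneg _), Real.sq_sqrt (by linarith)] at this

omit [BorelSpace E] [SecondCountableTopology E] in
lemma withDensity_zero_set (h : IsQuadraticBump c D φ) (μ : Measure E) {g : E → ℝ}
    (hg : ∀ x, φ x = 0 → g x ≤ 0) :
    μ.withDensity (fun x => ENNReal.ofReal (g x)) {x | φ x = 0} = 0 := by
  have hs : MeasurableSet {x | φ x = 0} := h.measurable (measurableSet_singleton 0)
  rw [withDensity_apply _ hs]
  exact setLIntegral_eq_zero hs fun x hx => ofReal_of_nonpos (hg x hx)

end IsQuadraticBump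

end Localize

section Localize

namespace IsQuadraticBump

variable {E : Type*} [MetricSpace E] [MeasurableSpace E] [BorelSpace E]
  [SecondCountableTopology E] [StandardBorelSpace E] [Nonempty E] {c : ℝ} {D φ : E → ℝ}

lemma exists_near_marginal (h : IsQuadraticBump c D φ) (π : Measure (E × E))
    [IsProbabilityMeasure π] :
    ∃ q : E → ℝ, Measurable q ∧ (∀ x, 0 ≤ q x) ∧ (∀ x, q x ≤ 3 * c ^ 2 * φ x) ∧
      (π.map Prod.fst).withDensity (fun x => ENNReal.ofReal (q x)) =
        (π.withDensity fun z => ENNReal.ofReal (nearPart D φ z)).map Prod.fst ∧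
      ∫⁻ x, ENNReal.ofReal ((q x - φ x) ^ 2 / φ x) ∂(π.map Prod.fst) ≤
        ENNReal.ofReal (4 * c ^ 3) * ∫⁻ z, edist z.1 z.2 ^ 2 ∂π := by
  have hc := h.one_le
  have hkm := h.measurable_nearPart
  have hk1 : ∀ z, nearPart D φ z ≤ 1 := fun z => (h.nearPart_le z).trans (h.le_one _)
  have hInt : ∀ x, Integrable (fun y => nearPart D φ (x, y)) (π.condKernel x) := fun x =>
    Integrable.of_bound (hkm.comp measurable_prodMk_left).aestronglyMeasurable 1
      (.of_forall fun y => by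
        rw [Real.norm_eq_abs, abs_of_nonneg (h.nearPart_nonneg _)]
        exact hk1 _)
  set q : E → ℝ := fun x => ∫ y, nearPart D φ (x, y) ∂(π.condKernel x) with hq
  have hqm : Measurable q := hkm.stronglyMeasurable.integral_kernel_prod_right'.measurable
  have hql : ∀ x, ENNReal.ofReal (q x) =
      ∫⁻ y, ENNReal.ofReal (nearPart D φ (x, y)) ∂(π.condKernel x) := fun x =>
    ofReal_integral_eq_lintegral_ofReal (hInt x) (.of_forall fun y => h.nearPart_nonneg _)
  refine ⟨q, hqm, fun x => integral_nonneg fun y => h.nearPart_nonneg _, fun x => ?_, ?_, ?_⟩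
  · have := integral_mono (hInt x) (integrable_const (3 * c ^ 2 * φ x)) fun y =>
      h.nearPart_le_mul (x, y)
    simpa using this
  · ext s hs
    rw [withDensity_apply _ hs, Measure.map_apply measurable_fst hs,
      withDensity_apply _ (measurable_fst hs), ← lintegral_indicator (measurable_fst hs),
      ← Measure.lintegral_condKernel (hkm.ennreal_ofReal.indicator (measurable_fst hs)),
      ← lintegral_indicator hs]
    refine lintegral_congr fun x => ?_
    by_cases hx : x ∈ s
    · rw [indicator_of_mem hx, hql]
      refine lintegral_congr fun y => ?_
      rw [indicator_of_mem (by exact hx)]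
    · rw [indicator_of_notMem hx]
      refine ((lintegral_congr fun y => ?_).trans lintegral_zero).symm
      exact indicator_of_notMem (by exact hx) _
  · rw [← lintegral_ofReal_mul_dist_sq π (by positivity),
      ← Measure.lintegral_condKernel (ρ := π)
        (f := fun z => ENNReal.ofReal (4 * c ^ 3 * dist z.1 z.2 ^ 2)) (by fun_prop)]
    refine lintegral_mono fun x => ?_
    by_cases hx : φ x = 0
    · simp [hx]
    have hx0 : 0 < φ x := lt_of_le_of_ne (h.nonneg x) (Ne.symm hx)
    have hq' : q x - φ x = ∫ y, (nearPart D φ (x, y) - φ x) ∂(π.condKernel x) := by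
      rw [integral_sub (hInt x) (integrable_const _)]
      simp [hq]
    have hj : ENNReal.ofReal ((q x - φ x) ^ 2) ≤
        ∫⁻ y, ENNReal.ofReal ((nearPart D φ (x, y) - φ x) ^ 2) ∂(π.condKernel x) := by
      rw [hq']
      refine ofReal_sq_integral_le _ (M := 1)
        ((hkm.comp measurable_prodMk_left).sub_const _) fun y => ?_
      rw [abs_le]
      constructor <;>
        linarith [hk1 (x, y), h.nearPart_nonneg (x, y), h.le_one x, h.nonneg x]
    rw [div_eq_inv_mul, ofReal_mul (inv_nonneg.2 hx0.le)]
    refine (mul_le_mul_right hj _).trans ?_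
    rw [← lintegral_const_mul' _ _ ofReal_ne_top]
    refine lintegral_mono fun y => ?_
    rw [← ofReal_mul (inv_nonneg.2 hx0.le)]
    refine ofReal_le_ofReal ?_
    rw [inv_mul_le_iff₀ hx0]
    refine (h.sq_nearPart_sub_le (x, y)).trans_eq ?_
    ring

end IsQuadraticBump

end Localize

section Localize

namespace IsQuadraticBump

variable {E : Type*} [MetricSpace E] [MeasurableSpace E] [BorelSpace E]
  [SecondCountableTopology E] {c : ℝ} {D φ : E → ℝ}

omit [BorelSpace E] [SecondCountableTopology E] in
lemma withDensity_univ (h : IsQuadraticBump c D φ) (μ : Measure E) [IsFiniteMeasure μ] :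
    μ.withDensity (fun x => ENNReal.ofReal (φ x)) univ = ENNReal.ofReal (∫ x, φ x ∂μ) := by
  rw [withDensity_apply _ .univ, Measure.restrict_univ, h.ofReal_integral]

omit [BorelSpace E] [SecondCountableTopology E] in
lemma isFiniteMeasure_withDensity (h : IsQuadraticBump c D φ) (μ : Measure E)
    [IsFiniteMeasure μ] : IsFiniteMeasure (μ.withDensity fun x => ENNReal.ofReal (φ x)) :=
  ⟨by rw [h.withDensity_univ]; exact ofReal_lt_top⟩

omit [BorelSpace E] [SecondCountableTopology E] in
lemma withDensity_mul_univ (h : IsQuadraticBump c D φ) (ν : Measure E) [IsFiniteMeasure ν]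
    {A : ℝ} (hA : 0 ≤ A) (hν : 0 < ∫ y, φ y ∂ν) :
    ν.withDensity (fun y => ENNReal.ofReal (A / (∫ y, φ y ∂ν) * φ y)) univ =
      ENNReal.ofReal A := by
  have h0 : 0 ≤ A / ∫ y, φ y ∂ν := by positivity
  rw [withDensity_apply _ .univ, Measure.restrict_univ]
  simp_rw [ofReal_mul h0]
  rw [lintegral_const_mul' _ _ ofReal_ne_top, ← h.ofReal_integral, ← ofReal_mul h0,
    div_mul_cancel₀ _ hν.ne']

/-- The estimate when `ν` sees much less of the bump than `μ` does. -/
lemma W2sq_le_of_integral_lt (h : IsQuadraticBump c D φ) (π : Measure (E × E))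
    [IsProbabilityMeasure π] {μ ν : Measure E} (hμ : π.map Prod.fst = μ)
    (hν : π.map Prod.snd = ν) {A₀ : ℝ} (hA₀ : 0 < A₀) (hA : A₀ ≤ ∫ x, φ x ∂μ)
    (hA' : 0 < ∫ y, φ y ∂ν) (hlt : 2 * ∫ y, φ y ∂ν ≤ ∫ x, φ x ∂μ) :
    W2sq (μ.withDensity fun x => ENNReal.ofReal (φ x))
        (ν.withDensity fun y => ENNReal.ofReal ((∫ x, φ x ∂μ) / (∫ y, φ y ∂ν) * φ y)) ≤
      ENNReal.ofReal (16 * c ^ 4 / A₀ ^ 2) * ∫⁻ z, edist z.1 z.2 ^ 2 ∂π := by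
  have hc := h.one_le
  have : IsProbabilityMeasure μ := hμ ▸ Measure.isProbabilityMeasure_map (by fun_prop)
  have : IsProbabilityMeasure ν := hν ▸ Measure.isProbabilityMeasure_map (by fun_prop)
  have hd := h.ofReal_sq_integral_sub_le π
  rw [hμ, hν] at hd
  have hA1 : ∫ x, φ x ∂μ ≤ 1 := by
    have := integral_mono (h.integrable μ) (integrable_const 1) h.le_one
    simpa using this
  have hM := h.withDensity_mul_univ ν (hA₀.le.trans hA) hA'
  have := h.isFiniteMeasure_withDensity μ
  have : IsFiniteMeasure (ν.withDensity fun y =>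
      ENNReal.ofReal ((∫ x, φ x ∂μ) / (∫ y, φ y ∂ν) * φ y)) := ⟨by rw [hM]; exact ofReal_lt_top⟩
  refine (h.W2sq_le_diam ?_ ?_ ?_).trans ?_
  · rw [hM, h.withDensity_univ]
  · exact h.withDensity_zero_set μ fun x hx => hx.le
  · exact h.withDensity_zero_set ν fun x hx => by simp [hx]
  rw [h.withDensity_univ]
  generalize ∫ x, φ x ∂μ = A at *
  generalize ∫ x, φ x ∂ν = A' at *
  have hA0 : 0 < A := hA₀.trans_le hA
  have hsq : A₀ ^ 2 ≤ 4 * (A - A') ^ 2 := by nlinarith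
  have hK : 4 * c * A ≤ 16 * c / A₀ ^ 2 * (A - A') ^ 2 := by
    rw [div_mul_eq_mul_div, le_div_iff₀ (by positivity)]
    calc 4 * c * A * A₀ ^ 2 ≤ 4 * c * 1 * (4 * (A - A') ^ 2) := by gcongr
      _ = _ := by ring
  rw [← ofReal_mul (by positivity)]
  refine (ofReal_le_ofReal hK).trans ?_
  rw [ofReal_mul (by positivity)]
  refine (mul_le_mul_right hd _).trans_eq ?_
  rw [← mul_assoc, ← ofReal_mul (by positivity)]
  congr 2
  ring

lemma map_snd_withDensity (h : IsQuadraticBump c D φ) (π : Measure (E × E)) :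
    (π.map Prod.snd).withDensity (fun y => ENNReal.ofReal (φ y)) =
      (π.withDensity fun z => ENNReal.ofReal (nearPart D φ z)).map Prod.snd +
        (π.withDensity fun z => ENNReal.ofReal (φ z.2 - nearPart D φ z)).map Prod.snd := by
  rw [← Measure.map_add _ _ measurable_snd, ← withDensity_ofReal_add π h.measurable_nearPart
    h.nearPart_nonneg (fun z => sub_nonneg.2 (h.nearPart_le z)),
    map_withDensity_comp π measurable_snd h.measurable.ennreal_ofReal]
  simp [Function.comp_def]

omit [BorelSpace E] [SecondCountableTopology E] in
/-- Transport of the near part of the bump along the plan itself. -/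
lemma W2sq_nearPart_le (h : IsQuadraticBump c D φ) (π : Measure (E × E)) :
    W2sq ((π.withDensity fun z => ENNReal.ofReal (nearPart D φ z)).map Prod.fst)
        ((π.withDensity fun z => ENNReal.ofReal (nearPart D φ z)).map Prod.snd) ≤
      ∫⁻ z, edist z.1 z.2 ^ 2 ∂π := by
  refine (W2sq_le _ rfl rfl).trans ?_
  refine lintegral_mono' ?_ le_rfl
  calc π.withDensity (fun z => ENNReal.ofReal (nearPart D φ z)) ≤ π.withDensity 1 :=
        withDensity_mono (.of_forall fun z => by
          simpa using (h.nearPart_le z).trans (h.le_one _))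
    _ = π := withDensity_one

omit [BorelSpace E] [SecondCountableTopology E] in
lemma ofReal_integral_sub_nearPart_le (h : IsQuadraticBump c D φ) (π : Measure (E × E))
    [IsFiniteMeasure π] :
    (π.withDensity fun z => ENNReal.ofReal (φ z.2 - nearPart D φ z)) univ ≤
      ENNReal.ofReal (9 * c) * ∫⁻ z, edist z.1 z.2 ^ 2 ∂π := by
  have hc := h.one_le
  rw [withDensity_apply _ .univ, Measure.restrict_univ,
    ← lintegral_ofReal_mul_dist_sq π (by positivity)]
  exact lintegral_mono fun z => ofReal_le_ofReal (h.sub_nearPart_le z)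

omit [BorelSpace E] [SecondCountableTopology E] in
/-- Adding a multiple of `φ` to a multiple of `q`, in terms of densities with respect to `φμ`. -/
lemma withDensity_withDensity_combination (h : IsQuadraticBump c D φ) (μ : Measure E)
    {q : E → ℝ} (hqm : Measurable q) (hq : ∀ x, 0 ≤ q x) (hq' : ∀ x, φ x = 0 → q x = 0)
    (a b : ℝ≥0) :
    (μ.withDensity fun x => ENNReal.ofReal (φ x)).withDensity
        (fun x => ENNReal.ofReal (a * (q x / φ x) + b)) =
      (a : ℝ≥0∞) • μ.withDensity (fun x => ENNReal.ofReal (q x)) +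
        (b : ℝ≥0∞) • μ.withDensity (fun x => ENNReal.ofReal (φ x)) := by
  have hm : Measurable fun x => a * (q x / φ x) + b := by
    have := h.measurable
    fun_prop
  rw [withDensity_ofReal_withDensity_ofReal μ h.measurable hm h.nonneg,
    ← withDensity_ofReal_const_mul μ hqm, ← withDensity_ofReal_const_mul μ h.measurable,
    ← withDensity_ofReal_add μ (g := fun x => a * q x) (h := fun x => b * φ x)
      (by fun_prop) (fun x => mul_nonneg a.2 (hq x))
      (fun x => mul_nonneg b.2 (h.nonneg x))]
  congr 1
  ext x
  congr 1
  by_cases hx : φ x = 0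
  · simp [hx, hq' x hx]
  · field_simp

omit [BorelSpace E] [SecondCountableTopology E] in
lemma lintegral_combination_sq_le (h : IsQuadraticBump c D φ) (μ : Measure E) [IsFiniteMeasure μ]
    {q : E → ℝ} (hqm : Measurable q) (a b : ℝ≥0) :
    ∫⁻ x, ENNReal.ofReal ((a * (q x / φ x) + b - 1) ^ 2)
        ∂(μ.withDensity fun x => ENNReal.ofReal (φ x)) ≤
      ENNReal.ofReal (3 * a ^ 2) * ∫⁻ x, ENNReal.ofReal ((q x - φ x) ^ 2 / φ x) ∂μ +
        ENNReal.ofReal (3 * ((a - 1) ^ 2 + b ^ 2) * ∫ x, φ x ∂μ) := by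
  have hφ := h.measurable
  rw [lintegral_withDensity_eq_lintegral_mul _ (by fun_prop) (by fun_prop),
    ofReal_mul (p := 3 * (((a : ℝ) - 1) ^ 2 + (b : ℝ) ^ 2)) (by positivity), h.ofReal_integral,
    ← lintegral_const_mul' _ _ ofReal_ne_top,
    ← lintegral_const_mul' _ _ ofReal_ne_top, ← lintegral_add_left (by fun_prop)]
  refine lintegral_mono fun x => ?_
  have h0 := h.nonneg x
  simp only [Pi.mul_apply]
  rw [← ofReal_mul h0, ← ofReal_mul (by positivity), ← ofReal_mul (by positivity),
    ← ofReal_add (by positivity) (by positivity)]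
  refine ofReal_le_ofReal ?_
  by_cases hx : φ x = 0
  · simp [hx]
  have hx0 : 0 < φ x := lt_of_le_of_ne h0 (Ne.symm hx)
  obtain ⟨t, ht⟩ : ∃ t, q x = φ x * (1 + t) := ⟨q x / φ x - 1, by field_simp; ring⟩
  have e1 : q x / φ x = 1 + t := by rw [ht]; field_simp
  have e2 : (q x - φ x) ^ 2 / φ x = φ x * t ^ 2 := by rw [ht]; field_simp; ring
  rw [e1, e2]
  have : ((a : ℝ) * (1 + t) + b - 1) ^ 2 ≤ 3 * (a ^ 2 * t ^ 2 + (a - 1) ^ 2 + b ^ 2) := by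
    nlinarith [sq_nonneg ((a : ℝ) * t - (a - 1)), sq_nonneg ((a : ℝ) * t - b),
      sq_nonneg ((a : ℝ) - 1 - b)]
  nlinarith [mul_le_mul_of_nonneg_left this h0]

end IsQuadraticBump

end Localize

section Localize

namespace IsQuadraticBump

variable {E : Type*} [MetricSpace E] [MeasurableSpace E] [BorelSpace E]
  [SecondCountableTopology E] [StandardBorelSpace E] [Nonempty E] {c : ℝ} {D φ : E → ℝ}

/-- The estimate when `μ` and `ν` see comparable amounts of the bump. -/
lemma W2sq_le_of_le_integral (h : IsQuadraticBump c D φ) (π : Measure (E × E))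
    [IsProbabilityMeasure π] {μ ν : Measure E} (hμ : π.map Prod.fst = μ)
    (hν : π.map Prod.snd = ν) {A₀ : ℝ} (hA₀ : 0 < A₀) (hA : A₀ ≤ ∫ x, φ x ∂μ)
    (hA' : 0 < ∫ y, φ y ∂ν) (hle : ∫ x, φ x ∂μ ≤ 2 * ∫ y, φ y ∂ν) {C : ℝ≥0}
    (hP : ∀ p : E → ℝ, Measurable p → (∀ x, 0 ≤ p x) → ∀ M : ℝ, (∀ x, p x ≤ M) →
      (μ.withDensity fun x => ENNReal.ofReal (φ x)).withDensity
          (fun x => ENNReal.ofReal (p x)) univ =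
        μ.withDensity (fun x => ENNReal.ofReal (φ x)) univ →
      W2sq (μ.withDensity fun x => ENNReal.ofReal (φ x))
        ((μ.withDensity fun x => ENNReal.ofReal (φ x)).withDensity
          fun x => ENNReal.ofReal (p x)) ≠ ⊤ →
      W2sq (μ.withDensity fun x => ENNReal.ofReal (φ x))
          ((μ.withDensity fun x => ENNReal.ofReal (φ x)).withDensity
            fun x => ENNReal.ofReal (p x)) ≤
        C * ∫⁻ x, ENNReal.ofReal ((p x - 1) ^ 2)
          ∂(μ.withDensity fun x => ENNReal.ofReal (φ x))) :
    W2sq (μ.withDensity fun x => ENNReal.ofReal (φ x))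
        (ν.withDensity fun y => ENNReal.ofReal ((∫ x, φ x ∂μ) / (∫ y, φ y ∂ν) * φ y)) ≤
      ENNReal.ofReal (2 * C * (48 * c ^ 3 + 12 * c ^ 3 / A₀ + 54 * c) + 2 * (2 + 72 * c ^ 2)) *
        ∫⁻ z, edist z.1 z.2 ^ 2 ∂π := by
  have hc := h.one_le
  have : IsProbabilityMeasure μ := hμ ▸ Measure.isProbabilityMeasure_map (by fun_prop)
  have : IsProbabilityMeasure ν := hν ▸ Measure.isProbabilityMeasure_map (by fun_prop)
  have hd := h.ofReal_sq_integral_sub_le π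
  rw [hμ, hν] at hd
  obtain ⟨q, hqm, hq0, hqle, hqμ, hqsq⟩ := h.exists_near_marginal π
  rw [hμ] at hqμ hqsq
  have hq' : ∀ x, φ x = 0 → q x = 0 := fun x hx =>
    le_antisymm (by simpa [hx] using hqle x) (hq0 x)
  have hnear := h.W2sq_nearPart_le π
  have hfar := h.ofReal_integral_sub_nearPart_le π
  have hsplit := h.map_snd_withDensity π
  rw [hν] at hsplit
  have hM := h.withDensity_mul_univ ν (hA₀.le.trans hA) hA'
  have hMφ := h.withDensity_univ μ
  have hMν := h.withDensity_univ ν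
  obtain ⟨T, hT⟩ : ∃ T, T = ∫⁻ z, edist z.1 z.2 ^ 2 ∂π := ⟨_, rfl⟩
  obtain ⟨A, hAe⟩ : ∃ A, A = ∫ x, φ x ∂μ := ⟨_, rfl⟩
  obtain ⟨A', hAe'⟩ : ∃ A', A' = ∫ x, φ x ∂ν := ⟨_, rfl⟩
  have hcomb := h.withDensity_withDensity_combination μ hqm hq0 hq'
  have hcombsq := h.lintegral_combination_sq_le μ hqm
  have hτ0 : ((π.withDensity fun z => ENNReal.ofReal (φ z.2 - nearPart D φ z)).map Prod.snd)
      {x | φ x = 0} = 0 := by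
    have h1 := h.withDensity_zero_set ν (g := φ) fun x hx => hx.le
    rw [hsplit, Measure.add_apply, add_eq_zero] at h1
    exact h1.2
  have hαs : μ.withDensity (fun x => ENNReal.ofReal (φ x)) {x | φ x = 0} = 0 :=
    h.withDensity_zero_set μ fun x hx => hx.le
  have hfα := h.isFiniteMeasure_withDensity μ
  have hmass₁ : μ.withDensity (fun x => ENNReal.ofReal (q x)) univ =
      ((π.withDensity fun z => ENNReal.ofReal (nearPart D φ z)).map Prod.snd) univ := by
    rw [hqμ, Measure.map_apply measurable_fst .univ, Measure.map_apply measurable_snd .univ,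
      preimage_univ, preimage_univ]
  rw [← hqμ] at hnear
  have hsm : ∀ a : ℝ≥0, (a : ℝ) = A / A' → ν.withDensity (fun y => ENNReal.ofReal (A / A' * φ y)) =
      (a : ℝ≥0∞) • ν.withDensity fun y => ENNReal.ofReal (φ y) := fun a ha => by
    rw [← ha, withDensity_ofReal_const_mul ν h.measurable]
  have hτT : ((π.withDensity fun z => ENNReal.ofReal (φ z.2 - nearPart D φ z)).map Prod.snd) univ ≤
      ENNReal.ofReal (9 * c) * T := by
    rwa [Measure.map_apply measurable_snd .univ, preimage_univ, hT]
  rw [← hT] at hqsq hnear hd ⊢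
  rw [← hAe, ← hAe'] at hd hM ⊢
  rw [← hAe] at hA hle hMφ
  simp only [← hAe] at hcombsq
  rw [← hAe'] at hA' hle hMν
  rw [hsplit] at hMν hsm
  obtain ⟨τ, hτ⟩ : ∃ τ, τ = (π.withDensity fun z =>
    ENNReal.ofReal (φ z.2 - nearPart D φ z)).map Prod.snd := ⟨_, rfl⟩
  obtain ⟨β, hβ⟩ : ∃ β, β = (π.withDensity fun z =>
    ENNReal.ofReal (nearPart D φ z)).map Prod.snd := ⟨_, rfl⟩
  obtain ⟨α, hα⟩ : ∃ α, α = μ.withDensity fun x => ENNReal.ofReal (φ x) := ⟨_, rfl⟩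
  obtain ⟨η, hη⟩ : ∃ η, η = μ.withDensity fun x => ENNReal.ofReal (q x) := ⟨_, rfl⟩
  obtain ⟨X, hX⟩ : ∃ X, X = ∫⁻ x, ENNReal.ofReal ((q x - φ x) ^ 2 / φ x) ∂μ := ⟨_, rfl⟩
  simp only [← hτ, ← hβ, ← hα, ← hη, ← hX] at *
  have hA0 : 0 < A := hA₀.trans_le hA
  rw [Measure.add_apply] at hMν
  have hτfin : τ univ ≠ ⊤ := fun h1 => by simp [h1] at hMν
  obtain ⟨M2, hM2⟩ : ∃ M2 : ℝ≥0, (M2 : ℝ≥0∞) = τ univ := ⟨_, coe_toNNReal hτfin⟩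
  have hM2A : (M2 : ℝ) ≤ A' := by
    have : (M2 : ℝ≥0∞) ≤ ENNReal.ofReal A' := by
      rw [hM2, ← hMν]
      exact le_add_self
    rw [← ENNReal.ofReal_coe_nnreal] at this
    exact (ofReal_le_ofReal_iff hA'.le).1 this
  obtain ⟨a, ha⟩ : ∃ a : ℝ≥0, (a : ℝ) = A / A' := ⟨⟨A / A', by positivity⟩, rfl⟩
  obtain ⟨b, hb⟩ : ∃ b : ℝ≥0, (b : ℝ) = M2 / A' := ⟨⟨M2 / A', by positivity⟩, rfl⟩
  have ha0 : a ≠ 0 := fun h0 => by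
    rw [h0, NNReal.coe_zero] at ha
    exact (div_pos hA0 hA').ne ha
  have ha2 : (a : ℝ) ≤ 2 := by rwa [ha, div_le_iff₀ hA']
  have hb1 : (b : ℝ) ≤ 1 := by rwa [hb, div_le_one hA']
  have hab : (b : ℝ) * A = a * M2 := by rw [ha, hb]; ring
  have hbα : ((b : ℝ≥0∞) • α) univ = ((a : ℝ≥0∞) • τ) univ := by
    rw [Measure.smul_apply, Measure.smul_apply, hMφ, ← hM2, smul_eq_mul, smul_eq_mul,
      ← ENNReal.ofReal_coe_nnreal, ← ENNReal.ofReal_coe_nnreal, ← ENNReal.ofReal_coe_nnreal,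
      ← ofReal_mul b.coe_nonneg, ← ofReal_mul a.coe_nonneg, hab]
  rw [hsm a ha, smul_add] at hM ⊢
  obtain ⟨p, hp⟩ : ∃ p : E → ℝ, p = fun x => a * (q x / φ x) + b := ⟨_, rfl⟩
  have hpα : α.withDensity (fun x => ENNReal.ofReal (p x)) =
      (a : ℝ≥0∞) • η + (b : ℝ≥0∞) • α := by rw [hp, hcomb]
  have hpm : Measurable p := by
    have := h.measurable
    rw [hp]
    fun_prop
  have hp0 : ∀ x, 0 ≤ p x := fun x => by
    rw [hp]
    have := hq0 x
    have := h.nonneg x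
    positivity
  have hpM : ∀ x, p x ≤ 2 * (3 * c ^ 2) + 1 := fun x => by
    rw [hp]
    have h1 : q x / φ x ≤ 3 * c ^ 2 := div_le_of_le_mul₀ (h.nonneg x) (by positivity) (hqle x)
    have h2 : 0 ≤ q x / φ x := div_nonneg (hq0 x) (h.nonneg x)
    have h3 : (a : ℝ) * (q x / φ x) ≤ 2 * (3 * c ^ 2) := mul_le_mul ha2 h1 h2 (by norm_num)
    show (a : ℝ) * (q x / φ x) + b ≤ _
    linarith
  have hmp : α.withDensity (fun x => ENNReal.ofReal (p x)) univ = α univ := by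
    rw [hpα, Measure.add_apply, hbα, Measure.smul_apply, hmass₁, hMφ, ← hM, Measure.add_apply]
    rfl
  have hfp : IsFiniteMeasure (α.withDensity fun x => ENNReal.ofReal (p x)) :=
    ⟨by rw [hmp]; exact measure_lt_top _ _⟩
  have hps : α.withDensity (fun x => ENNReal.ofReal (p x)) {x | φ x = 0} = 0 :=
    withDensity_absolutelyContinuous _ _ hαs
  have hfin : W2sq α (α.withDensity fun x => ENNReal.ofReal (p x)) ≠ ⊤ :=
    ne_top_of_le_ne_top (mul_ne_top ofReal_ne_top (measure_ne_top _ _))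
      (h.W2sq_le_diam hmp.symm hαs hps)
  have hfirst := hP p hpm hp0 _ hpM hmp hfin
  have hsq : ∫⁻ x, ENNReal.ofReal ((p x - 1) ^ 2) ∂α ≤
      ENNReal.ofReal (48 * c ^ 3 + 12 * c ^ 3 / A₀ + 54 * c) * T := by
    have hx : 3 * (((a : ℝ) - 1) ^ 2 + b ^ 2) * A ≤ 12 / A₀ * (A - A') ^ 2 + 6 * M2 := by
      have h1 : ((a : ℝ) - 1) ^ 2 * A ≤ 4 / A₀ * (A - A') ^ 2 := by
        have e : ((a : ℝ) - 1) ^ 2 * A = (A - A') ^ 2 * (A / A' ^ 2) := by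
          rw [ha]
          field_simp
        have e' : A / A' ^ 2 ≤ 4 / A₀ := by
          rw [div_le_div_iff₀ (by positivity) hA₀]
          nlinarith
        rw [e, mul_comm (4 / A₀)]
        gcongr
      have h2 : (b : ℝ) ^ 2 * A ≤ 2 * M2 := by
        have h3 : (a : ℝ) * M2 ≤ 2 * M2 := by gcongr
        have h4 : (b : ℝ) * (b * A) ≤ 1 * (b * A) := by gcongr
        calc (b : ℝ) ^ 2 * A = b * (b * A) := by ring
          _ ≤ 2 * M2 := by linarith
      calc _ = 3 * (((a : ℝ) - 1) ^ 2 * A) + 3 * ((b : ℝ) ^ 2 * A) := by ring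
        _ ≤ 3 * (4 / A₀ * (A - A') ^ 2) + 3 * (2 * M2) := by gcongr
        _ = _ := by ring
    have h12 : ENNReal.ofReal (3 * (a : ℝ) ^ 2) ≤ ENNReal.ofReal 12 :=
      ofReal_le_ofReal (by nlinarith [a.coe_nonneg])
    have h6 : ENNReal.ofReal (6 * (M2 : ℝ)) ≤
        ENNReal.ofReal 6 * (ENNReal.ofReal (9 * c) * T) := by
      rw [ofReal_mul (by norm_num), ENNReal.ofReal_coe_nnreal, hM2]
      gcongr
    have hdA : ENNReal.ofReal (12 / A₀ * (A - A') ^ 2) ≤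
        ENNReal.ofReal (12 / A₀) * (ENNReal.ofReal (c ^ 3) * T) := by
      rw [ofReal_mul (by positivity)]
      gcongr
    have hx' := ofReal_le_ofReal hx
    rw [ofReal_add (by positivity) (by positivity)] at hx'
    rw [hp]
    refine (hcombsq a b).trans ?_
    calc _ ≤ ENNReal.ofReal 12 * (ENNReal.ofReal (4 * c ^ 3) * T) +
          (ENNReal.ofReal (12 / A₀) * (ENNReal.ofReal (c ^ 3) * T) +
            ENNReal.ofReal 6 * (ENNReal.ofReal (9 * c) * T)) :=
          add_le_add (mul_le_mul' h12 hqsq) (hx'.trans (add_le_add hdA h6))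
      _ = ENNReal.ofReal (12 * (4 * c ^ 3) + (12 / A₀ * c ^ 3 + 6 * (9 * c))) * T := by
          rw [ofReal_add (by positivity) (by positivity),
            ofReal_add (by positivity) (by positivity), ofReal_mul (p := 12) (by positivity),
            ofReal_mul (p := 12 / A₀) (by positivity), ofReal_mul (p := 6) (by positivity)]
          ring
      _ = _ := by
          congr 2
          ring
  have hsecond : W2sq (α.withDensity fun x => ENNReal.ofReal (p x))
      ((a : ℝ≥0∞) • β + (a : ℝ≥0∞) • τ) ≤ ENNReal.ofReal (2 + 72 * c ^ 2) * T := by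
    have ha2' : (a : ℝ≥0∞) ≤ ENNReal.ofReal 2 := by
      rw [← ENNReal.ofReal_coe_nnreal]
      exact ofReal_le_ofReal ha2
    have hf₁ : IsFiniteMeasure ((b : ℝ≥0∞) • α) := Measure.smul_finite _ coe_ne_top
    have hf₂ : IsFiniteMeasure ((a : ℝ≥0∞) • τ) := ⟨by rw [← hbα]; exact measure_lt_top _ _⟩
    have h1 : W2sq ((a : ℝ≥0∞) • η) ((a : ℝ≥0∞) • β) ≤ ENNReal.ofReal 2 * T :=
      (W2sq_smul_le (by simpa using ha0) coe_ne_top _ _).trans (mul_le_mul' ha2' hnear)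
    have h2 : W2sq ((b : ℝ≥0∞) • α) ((a : ℝ≥0∞) • τ) ≤
        ENNReal.ofReal (4 * c) * (ENNReal.ofReal 2 * (ENNReal.ofReal (9 * c) * T)) := by
      refine (h.W2sq_le_diam hbα ?_ ?_).trans ?_
      · rw [Measure.smul_apply, hαs, smul_zero]
      · rw [Measure.smul_apply, hτ0, smul_zero]
      · rw [hbα, Measure.smul_apply, smul_eq_mul]
        gcongr
    rw [hpα]
    refine (W2sq_add_le _ _ _ _).trans ((add_le_add h1 h2).trans_eq ?_)
    rw [← mul_assoc, ← mul_assoc, ← ofReal_mul (by positivity), ← ofReal_mul (by positivity),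
      ← add_mul, ← ofReal_add (by positivity) (by positivity)]
    congr 2
    ring
  refine (W2sq_triangle (ν := α.withDensity fun x => ENNReal.ofReal (p x))
    (one_ne_zero (α := ℝ≥0))).trans ?_
  have e2 : ((1 + 1⁻¹ : ℝ≥0) : ℝ≥0∞) = ENNReal.ofReal 2 := by norm_num
  have e2' : ((1 + 1 : ℝ≥0) : ℝ≥0∞) = ENNReal.ofReal 2 := by norm_num
  rw [e2, e2']
  have hC : (C : ℝ≥0∞) = ENNReal.ofReal C := (ENNReal.ofReal_coe_nnreal).symm
  rw [hC] at hfirst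
  calc _ ≤ ENNReal.ofReal 2 * (ENNReal.ofReal C *
          (ENNReal.ofReal (48 * c ^ 3 + 12 * c ^ 3 / A₀ + 54 * c) * T)) +
        ENNReal.ofReal 2 * (ENNReal.ofReal (2 + 72 * c ^ 2) * T) := by
        gcongr
        exact hfirst.trans (mul_le_mul_right hsq _)
    _ = _ := by
        rw [← mul_assoc, ← mul_assoc, ← mul_assoc, ← ofReal_mul (by positivity),
          ← ofReal_mul (by positivity), ← ofReal_mul (by positivity), ← add_mul,
          ← ofReal_add (by positivity) (by positivity)]

end IsQuadraticBump

end Localize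

section Assembly

lemma le_smul_trans {E : Type*} [MeasurableSpace E] {m₁ m₂ m₃ : Measure E} {a b d : ℝ≥0∞}
    (h₁ : m₁ ≤ a • m₂) (h₂ : m₂ ≤ b • m₃) (h : a * b ≤ d) : m₁ ≤ d • m₃ := by
  refine Measure.le_iff.2 fun s _ => ?_
  calc m₁ s ≤ a * m₂ s := h₁ s
    _ ≤ a * (b * m₃ s) := by
      gcongr
      exact h₂ s
    _ ≤ d * m₃ s := by
      rw [← mul_assoc]
      gcongr

lemma withDensity_mono_left {E : Type*} [MeasurableSpace E] {m m' : Measure E} (h : m ≤ m')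
    (g : E → ℝ≥0∞) : m.withDensity g ≤ m'.withDensity g := by
  refine Measure.le_iff.2 fun s hs => ?_
  rw [withDensity_apply _ hs, withDensity_apply _ hs]
  exact lintegral_mono' (Measure.restrict_mono le_rfl h) le_rfl

lemma le_smul_withDensity_ofReal {E : Type*} [MeasurableSpace E] {m : Measure E} {f : E → ℝ}
    {c : ℝ} (hc : 0 < c) (hf : ∀ᵐ y ∂m, c⁻¹ ≤ f y) :
    m ≤ ENNReal.ofReal c • m.withDensity (fun y => ENNReal.ofReal (f y)) := by
  rw [← withDensity_smul' _ _ ofReal_ne_top]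
  refine withDensity_one.symm.le.trans (withDensity_mono ?_)
  filter_upwards [hf] with y hy
  rw [Pi.one_apply, Pi.smul_apply, smul_eq_mul, ← ofReal_mul hc.le, ← ofReal_one]
  refine ofReal_le_ofReal ?_
  rwa [inv_le_iff_one_le_mul₀' hc] at hy

lemma withDensity_ofReal_le_smul {E : Type*} [MeasurableSpace E] {m : Measure E} {f : E → ℝ}
    {c : ℝ} (hf : ∀ᵐ y ∂m, f y ≤ c) :
    m.withDensity (fun y => ENNReal.ofReal (f y)) ≤ ENNReal.ofReal c • m := by
  rw [← withDensity_const]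
  exact withDensity_mono (hf.mono fun y hy => ofReal_le_ofReal hy)

lemma withDensity_restrict_of_support {E : Type*} [MeasurableSpace E] (m : Measure E) {s : Set E}
    (hs : MeasurableSet s) {g : E → ℝ≥0∞} (hg : ∀ y, y ∉ s → g y = 0) :
    (m.restrict s).withDensity g = m.withDensity g := by
  rw [← withDensity_indicator hs, indicator_eq_self.2 fun y hy => by_contra fun h => hy (hg y h)]

lemma Wp_two_eq {E : Type*} [EMetricSpace E] [MeasurableSpace E] (μ ν : Measure E) :
    Wp 2 μ ν = W2sq μ ν ^ (1 / 2 : ℝ) := by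
  have := (orderIsoRpow (1 / 2) (by norm_num)).map_iInf₂
    (fun (π : Measure (E × E))
      (_ : π ∈ {π : Measure (E × E) | π.map Prod.fst = μ ∧ π.map Prod.snd = ν}) =>
      ∫⁻ z, edist z.1 z.2 ^ 2 ∂π)
  simp only [orderIsoRpow_apply] at this
  rw [W2sq, this, Wp]
  simp only [rpow_two]

lemma Wp_two_le {E : Type*} [EMetricSpace E] [MeasurableSpace E] {μ ν μ' ν' : Measure E} {K : ℝ}
    (hK : 0 ≤ K) (h : W2sq μ' ν' ≤ ENNReal.ofReal K * W2sq μ ν) :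
    Wp 2 μ' ν' ≤ ENNReal.ofReal (Real.sqrt K) * Wp 2 μ ν := by
  rw [Wp_two_eq, Wp_two_eq, Real.sqrt_eq_rpow, ← ofReal_rpow_of_nonneg hK (by norm_num),
    ← mul_rpow_of_nonneg _ _ (by norm_num)]
  exact rpow_le_rpow h (by norm_num)

variable {n : ℕ} {x₀ : EuclideanSpace ℝ (Fin n)} {r c₂ c₃ c₄ : ℝ}
  {f φ : EuclideanSpace ℝ (Fin n) → ℝ} {μ : Measure (EuclideanSpace ℝ (Fin n))}

lemma isQuadraticBump_of_radial (hc₂ : 0 < c₂) (hr : 0 < r) (hφ : ∀ y, φ y ∈ Icc (0 : ℝ) 1)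
    (hφL : ∃ K : ℝ≥0, LipschitzWith K φ)
    (hrad : ∀ y z, dist y x₀ = dist z x₀ → φ y = φ z)
    (hout : ∀ y, y ∉ closedBall x₀ r → φ y = 0)
    (hquad : ∀ y ∈ closedBall x₀ r,
      c₂⁻¹ * (r - dist y x₀) ^ 2 ≤ φ y ∧ φ y ≤ c₂ * (r - dist y x₀) ^ 2)
    (hgrad : ∀ y ∈ closedBall x₀ r, DifferentiableAt ℝ φ y →
      ‖fderiv ℝ φ y‖ ≤ c₂ * (r - dist y x₀)) :
    IsQuadraticBump c₂ (fun x => max 0 (r - dist x x₀)) φ := by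
  have hcen := hquad x₀ (mem_closedBall_self hr.le)
  rw [dist_self, sub_zero] at hcen
  have hr2 : r ^ 2 ≤ c₂ := by
    have := hcen.1.trans (hφ x₀).2
    rwa [inv_mul_le_iff₀ hc₂, mul_one] at this
  have h1 : 1 ≤ c₂ := by
    have := hcen.1.trans hcen.2
    rw [inv_mul_le_iff₀ hc₂] at this
    by_contra! h
    have h2 : 0 < r ^ 2 * (1 - c₂ * c₂) := mul_pos (by positivity) (by nlinarith)
    nlinarith
  have hD : ∀ x, max 0 (r - dist x x₀) ≤ r := fun x =>
    max_le hr.le (by linarith [dist_nonneg (x := x) (y := x₀)])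
  have hq : ∀ x, c₂⁻¹ * max 0 (r - dist x x₀) ^ 2 ≤ φ x ∧
      φ x ≤ c₂ * max 0 (r - dist x x₀) ^ 2 := fun x => by
    by_cases hx : x ∈ closedBall x₀ r
    · rw [max_eq_right (sub_nonneg.2 (mem_closedBall.1 hx))]
      exact hquad x hx
    · rw [hout x hx, max_eq_left (by rw [mem_closedBall, not_le] at hx; linarith)]
      simp
  refine ⟨h1, by fun_prop, ?_, fun x => le_max_left _ _, fun x y => ?_, fun x => ?_,
    fun x => (hφ x).1, fun x => (hφ x).2, fun x => ?_, fun x => (hq x).2, fun x y => ?_,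
    fun x y hx hy => ?_⟩
  · obtain ⟨K, hK⟩ := hφL
    exact hK.continuous.measurable
  · have := dist_triangle x y x₀
    refine max_le (add_nonneg (le_max_left _ _) dist_nonneg) ?_
    have := le_max_right 0 (r - dist x x₀)
    linarith
  · exact (pow_le_pow_left₀ (le_max_left _ _) (hD x) 2).trans hr2
  · have := (hq x).1
    rwa [inv_mul_le_iff₀ hc₂] at this
  · refine (abs_bump_sub_le hc₂ hφ hφL hrad hout hquad hgrad x y).trans_eq ?_
    rw [max_max_max_comm, max_self]
  · have hb : ∀ z, φ z ≠ 0 → dist z x₀ ≤ r := fun z hz =>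
      mem_closedBall.1 (by_contra fun h => hz (hout z h))
    have h3 := dist_triangle_right x y x₀
    have h4 : dist x y ≤ 2 * r := by linarith [hb x hx, hb y hy]
    calc dist x y ^ 2 ≤ (2 * r) ^ 2 := by gcongr
      _ = 4 * r ^ 2 := by ring
      _ ≤ 4 * c₂ := by linarith

lemma coneWeight_eq (x₀ : EuclideanSpace ℝ (Fin n)) (r : ℝ) :
    coneWeight x₀ r =
      volume.withDensity fun x => ENNReal.ofReal (4 * max 0 (r - dist x x₀) ^ 2) := by
  unfold coneWeight
  congr 1
  ext x
  rcases le_total (r - dist x x₀) 0 with h | h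
  · rw [max_eq_left h, ofReal_of_nonpos (by linarith)]
    simp
  · rw [max_eq_right h, ← ofReal_pow (by linarith)]
    congr 1
    ring

lemma withDensity_le_smul_coneWeight
    (h : IsQuadraticBump c₂ (fun x => max 0 (r - dist x x₀)) φ)
    (hout : ∀ y, y ∉ closedBall x₀ r → φ y = 0)
    (hf : μ.restrict (closedBall x₀ r) =
      (volume.restrict (closedBall x₀ r)).withDensity (fun y => ENNReal.ofReal (f y)))
    (hf' : ∀ᵐ y ∂(volume.restrict (closedBall x₀ r)), c₄⁻¹ ≤ f y ∧ f y ≤ c₄) (hc₄ : 0 < c₄) :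
    μ.withDensity (fun x => ENNReal.ofReal (φ x)) ≤ ENNReal.ofReal (4 * c₂ * c₄) •
      coneWeight x₀ r := by
  have hc := h.one_le
  have h0 : ∀ y, y ∉ closedBall x₀ r → ENNReal.ofReal (φ y) = 0 := fun y hy => by simp [hout y hy]
  have h1 : μ.restrict (closedBall x₀ r) ≤ ENNReal.ofReal c₄ • volume := by
    rw [hf]
    refine (withDensity_ofReal_le_smul (hf'.mono fun y hy => hy.2)).trans ?_
    gcongr
    exact Measure.restrict_le_self
  rw [← withDensity_restrict_of_support μ measurableSet_closedBall h0]
  refine (withDensity_mono_left h1 _).trans ?_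
  rw [withDensity_smul_measure, mul_comm, ofReal_mul hc₄.le, mul_smul]
  gcongr
  rw [coneWeight_eq, ← withDensity_smul' _ _ ofReal_ne_top]
  refine withDensity_mono (.of_forall fun x => ?_)
  rw [Pi.smul_apply, smul_eq_mul, ← ofReal_mul (by positivity)]
  refine ofReal_le_ofReal ((h.le_sq x).trans ?_)
  have : 0 ≤ c₂ * max 0 (r - dist x x₀) ^ 2 := by positivity
  nlinarith

lemma coneWeight_le_smul_withDensity
    (h : IsQuadraticBump c₂ (fun x => max 0 (r - dist x x₀)) φ)
    (hf : μ.restrict (closedBall x₀ r) =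
      (volume.restrict (closedBall x₀ r)).withDensity (fun y => ENNReal.ofReal (f y)))
    (hf' : ∀ᵐ y ∂(volume.restrict (closedBall x₀ r)), c₄⁻¹ ≤ f y ∧ f y ≤ c₄) (hc₄ : 0 < c₄) :
    coneWeight x₀ r ≤ ENNReal.ofReal (4 * c₂ * c₄) •
      μ.withDensity (fun x => ENNReal.ofReal (φ x)) := by
  have hc := h.one_le
  have h1 : volume.restrict (closedBall x₀ r) ≤ ENNReal.ofReal c₄ • μ := by
    refine (le_smul_withDensity_ofReal hc₄ (hf'.mono fun y hy => hy.1)).trans ?_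
    rw [← hf]
    gcongr
    exact Measure.restrict_le_self
  rw [coneWeight_eq, ← withDensity_restrict_of_support volume
    (measurableSet_closedBall (x := x₀) (ε := r)) fun y hy => by
      rw [mem_closedBall, not_le] at hy
      rw [max_eq_left (by linarith)]
      simp]
  refine (withDensity_mono_left h1 _).trans ?_
  rw [withDensity_smul_measure, mul_comm, ofReal_mul hc₄.le, mul_smul]
  gcongr
  rw [← withDensity_smul' _ _ ofReal_ne_top]
  refine withDensity_mono (.of_forall fun x => ?_)
  rw [Pi.smul_apply, smul_eq_mul, ← ofReal_mul (by positivity)]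
  refine ofReal_le_ofReal ?_
  have := h.sq_le x
  linarith

lemma le_integral_of_coneWeight_le {ρ : ℝ} (hρ : 0 < ρ) (hρr : ρ ≤ r)
    [IsFiniteMeasure μ] (h : IsQuadraticBump c₂ (fun x => max 0 (r - dist x x₀)) φ) {K : ℝ}
    (hK : 0 < K)
    (hle : coneWeight x₀ r ≤ ENNReal.ofReal K • μ.withDensity (fun x => ENNReal.ofReal (φ x))) :
    ρ ^ 2 * volume.real (closedBall (0 : EuclideanSpace ℝ (Fin n)) (ρ / 2)) / K ≤
      ∫ x, φ x ∂μ := by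
  have h1 : ENNReal.ofReal (ρ ^ 2) * volume (closedBall x₀ (ρ / 2)) ≤ coneWeight x₀ r univ := by
    rw [coneWeight_eq, withDensity_apply _ .univ, ← setLIntegral_const]
    refine (setLIntegral_mono' measurableSet_closedBall fun x hx => ?_).trans
      (lintegral_mono_set (subset_univ _))
    refine ofReal_le_ofReal ?_
    have h2 : ρ / 2 ≤ max 0 (r - dist x x₀) :=
      le_max_of_le_right (by linarith [mem_closedBall.1 hx])
    nlinarith
  have h2 := h1.trans (hle univ)
  rw [Measure.smul_apply, smul_eq_mul, h.withDensity_univ, ← ofReal_mul hK.le,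
    Measure.addHaar_closedBall_center, ← ofReal_toReal measure_closedBall_lt_top.ne,
    ← ofReal_mul (by positivity), ofReal_le_ofReal_iff
      (mul_nonneg hK.le (integral_nonneg h.nonneg))] at h2
  rw [div_le_iff₀ hK, mul_comm _ K]
  exact h2

lemma integral_pos_of_measure_ball_pos [IsFiniteMeasure μ]
    (h : IsQuadraticBump c₂ (fun x => max 0 (r - dist x x₀)) φ) (hμ : 0 < μ (ball x₀ r)) :
    0 < ∫ x, φ x ∂μ := by
  rw [integral_pos_iff_support_of_nonneg h.nonneg (h.integrable μ)]
  refine hμ.trans_le (measure_mono fun x hx h0 => ?_)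
  have h1 := h.sq_le x
  rw [h0, mul_zero, max_eq_right (by linarith [mem_ball.1 hx])] at h1
  have : 0 < r - dist x x₀ := by linarith [mem_ball.1 hx]
  nlinarith

end Assembly

/-- Theorem 1.1, localization of `W₂` on a ball.
If `μ, ν` are probability measures on `ℝⁿ` with finite second moments, `B` is a closed ball of
radius `r ≥ c₃⁻¹` with `μ(int B), ν(int B) > 0`, `μ⌊B = f dx` with `c₄⁻¹ ≤ f ≤ c₄` a.e. on `B`,
and `φ : ℝⁿ → [0,1]` is a radial Lipschitz bump supported on `B` with
`c₂⁻¹ dist(x,∂B)² ≤ φ(x) ≤ c₂ dist(x,∂B)²` and `|∇φ(x)| ≤ c₂ dist(x,∂B)` on `B`, then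
`W₂(φμ, a φν) ≤ c W₂(μ,ν)` with `a = (∫φ dμ)/(∫φ dν)`, where `c = c(n, c₂, c₃, c₄)`. -/
theorem statement0 (n : ℕ) (c₂ c₃ c₄ : ℝ) (hc₂ : 0 < c₂) (hc₃ : 0 < c₃) (hc₄ : 0 < c₄) :
    ∃ c : ℝ, 0 < c ∧
      ∀ (μ ν : Measure (EuclideanSpace ℝ (Fin n))),
        IsProbabilityMeasure μ → IsProbabilityMeasure ν →
        (∫⁻ x, (‖x‖₊ : ℝ≥0∞) ^ 2 ∂μ) < ⊤ → (∫⁻ x, (‖x‖₊ : ℝ≥0∞) ^ 2 ∂ν) < ⊤ →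
        ∀ (x₀ : EuclideanSpace ℝ (Fin n)) (r : ℝ), c₃⁻¹ ≤ r →
        0 < μ (ball x₀ r) → 0 < ν (ball x₀ r) →
        ∀ f : EuclideanSpace ℝ (Fin n) → ℝ,
          μ.restrict (closedBall x₀ r) =
            (volume.restrict (closedBall x₀ r)).withDensity (fun y => ENNReal.ofReal (f y)) →
          (∀ᵐ y ∂(volume.restrict (closedBall x₀ r)), c₄⁻¹ ≤ f y ∧ f y ≤ c₄) →
        ∀ φ : EuclideanSpace ℝ (Fin n) → ℝ,
          (∀ y, φ y ∈ Icc (0:ℝ) 1) →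
          (∃ K : ℝ≥0, LipschitzWith K φ) →
          (∀ y z, dist y x₀ = dist z x₀ → φ y = φ z) →
          (∀ y, y ∉ closedBall x₀ r → φ y = 0) →
          (∀ y ∈ closedBall x₀ r,
            c₂⁻¹ * (r - dist y x₀) ^ 2 ≤ φ y ∧ φ y ≤ c₂ * (r - dist y x₀) ^ 2) →
          (∀ y ∈ closedBall x₀ r, DifferentiableAt ℝ φ y →
            ‖fderiv ℝ φ y‖ ≤ c₂ * (r - dist y x₀)) →
          Wp 2 (μ.withDensity fun y => ENNReal.ofReal (φ y))
              (ν.withDensity fun y =>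
                ENNReal.ofReal ((∫ z, φ z ∂μ) / (∫ z, φ z ∂ν) * φ y)) ≤
            ENNReal.ofReal c * Wp 2 μ ν := by
  obtain ⟨R, hR⟩ : ∃ R : ℝ≥0, R = max 1 (max c₃ (Real.sqrt c₂)).toNNReal := ⟨_, rfl⟩
  have hR1 : 1 ≤ R := hR ▸ le_max_left _ _
  have hR' : max c₃ (Real.sqrt c₂) ≤ R := by
    rw [← Real.toNNReal_le_iff_le_coe, hR]
    exact le_max_right _ _
  obtain ⟨C, L, hL, hmodel⟩ := exists_model n hR1
  obtain ⟨K, hK⟩ : ∃ K : ℝ, K = 4 * c₂ * c₄ := ⟨_, rfl⟩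
  have hK0 : 0 < K := by rw [hK]; positivity
  obtain ⟨L', hL'⟩ : ∃ L' : ℝ≥0, L' = max 1 (L * K.toNNReal) := ⟨_, rfl⟩
  have hL'1 : 1 ≤ L' := hL' ▸ le_max_left _ _
  have hL'K : (L : ℝ≥0∞) * ENNReal.ofReal K ≤ L' := by
    rw [hL']
    rw [ENNReal.ofReal, ← coe_mul]
    exact coe_le_coe.2 (le_max_right (1 : ℝ≥0) (L * K.toNNReal))
  obtain ⟨C', hC'⟩ : ∃ C' : ℝ≥0, C' = (1 + 2 * L' ^ 2) * (2 * L' ^ 2) ^ 2 * C := ⟨_, rfl⟩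
  obtain ⟨A₀, hA₀⟩ : ∃ A₀ : ℝ, A₀ = c₃⁻¹ ^ 2 *
    volume.real (closedBall (0 : EuclideanSpace ℝ (Fin n)) (c₃⁻¹ / 2)) / K := ⟨_, rfl⟩
  have hA₀0 : 0 < A₀ := by
    have : 0 < volume.real (closedBall (0 : EuclideanSpace ℝ (Fin n)) (c₃⁻¹ / 2)) :=
      toReal_pos (measure_closedBall_pos volume _ (by positivity)).ne'
        measure_closedBall_lt_top.ne
    rw [hA₀]
    positivity
  obtain ⟨c, hc⟩ : ∃ c : ℝ, c = 16 * c₂ ^ 4 / A₀ ^ 2 +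
    (2 * C' * (48 * c₂ ^ 3 + 12 * c₂ ^ 3 / A₀ + 54 * c₂) + 2 * (2 + 72 * c₂ ^ 2)) := ⟨_, rfl⟩
  have hc0 : 0 < c := by rw [hc]; positivity
  refine ⟨Real.sqrt c, Real.sqrt_pos.2 hc0, ?_⟩
  intro μ ν hμp hνp _ _ x₀ r hr hμB hνB f hf hf' φ hφ hφL hrad hout hquad hgrad
  have hr0 : 0 < r := (inv_pos.2 hc₃).trans_le hr
  have h := isQuadraticBump_of_radial hc₂ hr0 hφ hφL hrad hout hquad hgrad
  have hup := withDensity_le_smul_coneWeight h hout hf hf' hc₄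
  have hlow := coneWeight_le_smul_withDensity h hf hf' hc₄
  rw [← hK] at hup hlow
  have hA := le_integral_of_coneWeight_le (inv_pos.2 hc₃) hr h hK0 hlow
  rw [← hA₀] at hA
  have hA' := integral_pos_of_measure_ball_pos h hνB
  have hfin := h.isFiniteMeasure_withDensity μ
  have hrR : r ≤ R := by
    refine (Real.le_sqrt_of_sq_le ?_).trans ((le_max_right _ _).trans hR')
    have := h.dist_sq_le x₀
    rwa [dist_self, sub_zero, max_eq_right hr0.le] at this
  have hrR' : (R : ℝ)⁻¹ ≤ r := by
    refine le_trans ?_ hr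
    gcongr
    exact (le_max_left _ _).trans hR'
  obtain ⟨m, hm, hP, hm₁, hm₂⟩ := hmodel x₀ r hrR' hrR
  have hmφ := le_smul_trans hm₁ hlow hL'K
  have hφm := le_smul_trans hup hm₂ ((mul_comm _ _).trans_le hL'K)
  refine Wp_two_le hc0.le ?_
  rw [← add_zero (ENNReal.ofReal c * W2sq μ ν)]
  refine le_mul_W2sq_add (by simpa using hc0) ofReal_ne_top fun π h₁ h₂ => ?_
  have hπ : IsProbabilityMeasure π := by
    refine ⟨?_⟩
    have := hμp.measure_univ
    rwa [← h₁, Measure.map_apply measurable_fst .univ, preimage_univ] at this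
  rw [add_zero]
  rcases le_total (2 * ∫ y, φ y ∂ν) (∫ x, φ x ∂μ) with hlt | hle
  · refine (h.W2sq_le_of_integral_lt π h₁ h₂ hA₀0 hA hA' hlt).trans ?_
    gcongr
    rw [hc]
    exact le_add_of_nonneg_right (by positivity)
  · refine (h.W2sq_le_of_le_integral π h₁ h₂ hA₀0 hA hA' hle (C := C')
      fun p hp hp0 M hM hmass hW => ?_).trans ?_
    · rw [hC']
      exact hP.of_comparable hL'1 hmφ hφm hp hp0 hM hmass hW
    · gcongr
      rw [hc]
      exact le_add_of_nonneg_left (by positivity)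
end
end

section
/- Let μ and ν be Borel probability measures on ℝⁿ with finite first moments and let B be a ball with radius c₃⁻¹ ≤ r(B) ≤ c₃. Let φ : ℝⁿ → [0,∞) be a Lipschitz function supported on B with ‖∇φ‖_∞ ≤ c₆. Suppose ∫φ dμ ≥ c₇ > 0 and ∫φ dν > 0. Then W₁(φμ, a·φν) ≤ c·W₁(μ,ν), where a = (∫φ dμ)/(∫φ dν) and c depends only on n, c₃, c₆, c₇. -/
open MeasureTheory Metric Set ENNReal
open scoped NNReal

noncomputable section

theorem map_withDensity_comp_s2 {α β : Type*} [MeasurableSpace α] [MeasurableSpace β]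
    (π : Measure α) {T : α → β} (hT : Measurable T) {f : β → ℝ≥0∞} (hf : Measurable f) :
    (π.withDensity fun z => f (T z)).map T = (π.map T).withDensity f := by
  ext s hs
  rw [Measure.map_apply hT hs, withDensity_apply _ (hT hs), withDensity_apply _ hs,
    setLIntegral_map hs hf hT]

/-- Two finite measures of the same mass have a coupling, the normalized product. -/
theorem exists_coupling_of_mass_eq {α β : Type*} [MeasurableSpace α] [MeasurableSpace β]
    (μ : Measure α) (ν : Measure β) [IsFiniteMeasure μ] [IsFiniteMeasure ν]
    (h : μ univ = ν univ) :
    ∃ π : Measure (α × β), π.map Prod.fst = μ ∧ π.map Prod.snd = ν := by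
  by_cases h0 : μ univ = 0
  · have hμ : μ = 0 := Measure.measure_univ_eq_zero.1 h0
    have hν : ν = 0 := Measure.measure_univ_eq_zero.1 (h ▸ h0)
    exact ⟨0, by simp [hμ], by simp [hν]⟩
  · refine ⟨(μ univ)⁻¹ • μ.prod ν, ?_, ?_⟩
    · rw [Measure.map_smul, Measure.map_fst_prod, smul_smul, ← h,
        ENNReal.inv_mul_cancel h0 (measure_ne_top _ _), one_smul]
    · rw [Measure.map_smul, Measure.map_snd_prod, smul_smul,
        ENNReal.inv_mul_cancel h0 (measure_ne_top _ _), one_smul]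

theorem Wp_one_le {E : Type*} [EMetricSpace E] [MeasurableSpace E] {μ ν : Measure E}
    {π : Measure (E × E)} (h₁ : π.map Prod.fst = μ) (h₂ : π.map Prod.snd = ν) :
    Wp 1 μ ν ≤ ∫⁻ z, edist z.1 z.2 ∂π := by
  simpa [Wp] using iInf₂_le (f := fun (π : Measure (E × E))
    (_ : π ∈ {π : Measure (E × E) | π.map Prod.fst = μ ∧ π.map Prod.snd = ν}) =>
      (∫⁻ z, edist z.1 z.2 ^ (1 : ℝ) ∂π) ^ (1 / (1 : ℝ))) π ⟨h₁, h₂⟩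

theorem le_mul_Wp_one {E : Type*} [EMetricSpace E] [MeasurableSpace E] {μ ν : Measure E}
    {C A : ℝ≥0∞} (hC : C ≠ 0) (hC' : C ≠ ⊤)
    (h : ∀ π : Measure (E × E), π.map Prod.fst = μ → π.map Prod.snd = ν →
      A ≤ C * ∫⁻ z, edist z.1 z.2 ∂π) :
    A ≤ C * Wp 1 μ ν := by
  rw [← ENNReal.div_le_iff' hC hC']
  refine le_iInf₂ fun π hπ => ?_
  rw [ENNReal.div_le_iff' hC hC']
  simpa using h π hπ.1 hπ.2

/-- Keep the common part `min (f x) (g y)` of a coupling in place and recouple the rest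
arbitrarily; the rest lives in a ball of radius `r`. -/
theorem Wp_one_withDensity_le {E : Type*} [EMetricSpace E] [MeasurableSpace E] [BorelSpace E]
    [SecondCountableTopology E] (π : Measure (E × E))
    {f g : E → ℝ≥0∞} (hf : Measurable f) (hg : Measurable g)
    (hfg : ∫⁻ z, f z.1 ∂π = ∫⁻ z, g z.2 ∂π) (hfin : ∫⁻ z, f z.1 ∂π ≠ ⊤)
    (x₀ : E) {r : ℝ≥0∞} (hfr : ∀ x, f x ≠ 0 → edist x x₀ ≤ r)
    (hgr : ∀ x, g x ≠ 0 → edist x x₀ ≤ r) :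
    Wp 1 ((π.map Prod.fst).withDensity f) ((π.map Prod.snd).withDensity g) ≤
      ∫⁻ z, min (f z.1) (g z.2) * edist z.1 z.2 ∂π + 2 * r * ∫⁻ z, (f z.1 - g z.2) ∂π := by
  have hF : Measurable fun z : E × E => f z.1 := hf.comp measurable_fst
  have hG : Measurable fun z : E × E => g z.2 := hg.comp measurable_snd
  have hFG : Measurable fun z : E × E => f z.1 - g z.2 := hF.sub hG
  have hGF : Measurable fun z : E × E => g z.2 - f z.1 := hG.sub hF
  have hmin : Measurable fun z : E × E => min (f z.1) (g z.2) := hF.min hG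
  have splitF : ∀ z : E × E, min (f z.1) (g z.2) + (f z.1 - g z.2) = f z.1 := fun z => by
    rcases le_total (f z.1) (g z.2) with h | h
    · simp [h, tsub_eq_zero_of_le h]
    · simp [h, add_tsub_cancel_of_le h]
  have splitG : ∀ z : E × E, min (f z.1) (g z.2) + (g z.2 - f z.1) = g z.2 := fun z => by
    rcases le_total (f z.1) (g z.2) with h | h
    · simp [h, add_tsub_cancel_of_le h]
    · simp [h, tsub_eq_zero_of_le h]
  have hδF : ∫⁻ z, (f z.1 - g z.2) ∂π ≠ ⊤ :=
    ne_top_of_le_ne_top hfin (lintegral_mono fun z => tsub_le_self)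
  have hmfin : ∫⁻ z, min (f z.1) (g z.2) ∂π ≠ ⊤ :=
    ne_top_of_le_ne_top hfin (lintegral_mono fun z => min_le_left _ _)
  have hδ : ∫⁻ z, (f z.1 - g z.2) ∂π = ∫⁻ z, (g z.2 - f z.1) ∂π := by
    rw [← ENNReal.add_right_inj hmfin, ← lintegral_add_left hmin, ← lintegral_add_left hmin]
    simpa only [splitF, splitG] using hfg
  have : IsFiniteMeasure (π.withDensity fun z => f z.1 - g z.2) := isFiniteMeasure_withDensity hδF
  have : IsFiniteMeasure (π.withDensity fun z => g z.2 - f z.1) :=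
    isFiniteMeasure_withDensity (hδ ▸ hδF)
  obtain ⟨σ, hσ₁, hσ₂⟩ := exists_coupling_of_mass_eq
    ((π.withDensity fun z => f z.1 - g z.2).map Prod.fst)
    ((π.withDensity fun z => g z.2 - f z.1).map Prod.snd) (by
      rw [Measure.map_apply measurable_fst .univ, Measure.map_apply measurable_snd .univ]
      simpa using hδ)
  have hd : Measurable fun z : E × E => edist z.1 z.2 := measurable_fst.edist measurable_snd
  have hx : Measurable fun x : E => edist x x₀ := measurable_edist_left
  have hx₁ : Measurable fun z : E × E => edist z.1 x₀ := hx.comp measurable_fst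
  have hx₂ : Measurable fun z : E × E => edist z.2 x₀ := hx.comp measurable_snd
  refine (Wp_one_le (π := (π.withDensity fun z => min (f z.1) (g z.2)) + σ) ?_ ?_).trans ?_
  · rw [Measure.map_add _ _ measurable_fst, hσ₁, ← Measure.map_add _ _ measurable_fst,
      ← withDensity_add_left hmin, ← map_withDensity_comp_s2 π measurable_fst hf]
    congr 2
    exact funext splitF
  · rw [Measure.map_add _ _ measurable_snd, hσ₂, ← Measure.map_add _ _ measurable_snd,
      ← withDensity_add_left hmin, ← map_withDensity_comp_s2 π measurable_snd hg]
    congr 2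
    exact funext splitG
  rw [lintegral_add_measure, lintegral_withDensity_eq_lintegral_mul _ hmin hd]
  refine add_le_add le_rfl ?_
  have h₁ : ∫⁻ z, edist z.1 x₀ ∂σ ≤ r * ∫⁻ z, (f z.1 - g z.2) ∂π := by
    rw [← lintegral_map hx measurable_fst, hσ₁, lintegral_map hx measurable_fst,
      lintegral_withDensity_eq_lintegral_mul _ hFG hx₁, ← lintegral_const_mul _ hFG]
    refine lintegral_mono fun z => ?_
    rw [Pi.mul_apply, mul_comm]
    by_cases h : f z.1 = 0
    · simp [h]
    · exact mul_le_mul_left (hfr _ h) _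
  have h₂ : ∫⁻ z, edist z.2 x₀ ∂σ ≤ r * ∫⁻ z, (f z.1 - g z.2) ∂π := by
    rw [hδ, ← lintegral_map hx measurable_snd, hσ₂, lintegral_map hx measurable_snd,
      lintegral_withDensity_eq_lintegral_mul _ hGF hx₂, ← lintegral_const_mul _ hGF]
    refine lintegral_mono fun z => ?_
    rw [Pi.mul_apply, mul_comm]
    by_cases h : g z.2 = 0
    · simp [h]
    · exact mul_le_mul_left (hgr _ h) _
  calc ∫⁻ z, edist z.1 z.2 ∂σ ≤ ∫⁻ z, (edist z.1 x₀ + edist z.2 x₀) ∂σ :=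
        lintegral_mono fun z => edist_triangle_right _ _ _
    _ = ∫⁻ z, edist z.1 x₀ ∂σ + ∫⁻ z, edist z.2 x₀ ∂σ := lintegral_add_left hx₁ _
    _ ≤ _ := add_le_add h₁ h₂
    _ = _ := by rw [mul_assoc, two_mul]

/-- A nonnegative Lipschitz function supported in a ball of radius `r` is bounded by `3 K r`,
unless the space is a point. -/
theorem LipschitzWith.le_of_support_subset_closedBall {E : Type*} [NormedAddCommGroup E]
    [NormedSpace ℝ E] [Nontrivial E] {φ : E → ℝ} {K : ℝ≥0} (hφ : LipschitzWith K φ)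
    {x₀ : E} {r : ℝ} (hr : 0 < r) (hs : ∀ y, y ∉ closedBall x₀ r → φ y = 0) (y : E) :
    φ y ≤ K * (3 * r) := by
  by_cases hy : y ∈ closedBall x₀ r
  · obtain ⟨v, hv⟩ := exists_norm_eq E (show 0 ≤ 2 * r by positivity)
    have hz : φ (x₀ + v) = 0 := hs _ (by simp [hv]; linarith)
    have h := hφ.dist_le_mul y (x₀ + v)
    have h' : dist y (x₀ + v) ≤ 3 * r := by
      have := dist_triangle y x₀ (x₀ + v)
      have : dist x₀ (x₀ + v) = 2 * r := by simp [hv]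
      have := mem_closedBall.1 hy
      linarith
    rw [Real.dist_eq, hz, sub_zero] at h
    exact (le_abs_self _).trans (h.trans (by gcongr))
  · rw [hs y hy]
    positivity

/-- Proposition 3.1, localization of `W₁`.
If `μ, ν` are probability measures on `ℝⁿ` with finite first moments, `B` a ball with
`c₃⁻¹ ≤ r(B) ≤ c₃`, and `φ ≥ 0` a Lipschitz function supported on `B` with `‖∇φ‖_∞ ≤ c₆`,
`∫φ dμ ≥ c₇ > 0` and `∫φ dν > 0`, then `W₁(φμ, a φν) ≤ c W₁(μ,ν)` with
`a = (∫φ dμ)/(∫φ dν)`, where `c` depends only on `n, c₃, c₆, c₇`. -/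
theorem statement2 (n : ℕ) (c₃ c₆ c₇ : ℝ) (hc₃ : 0 < c₃) (hc₆ : 0 < c₆) (hc₇ : 0 < c₇) :
    ∃ c : ℝ, 0 < c ∧
      ∀ (μ ν : Measure (EuclideanSpace ℝ (Fin n))),
        IsProbabilityMeasure μ → IsProbabilityMeasure ν →
        (∫⁻ x, (‖x‖₊ : ℝ≥0∞) ∂μ) < ⊤ → (∫⁻ x, (‖x‖₊ : ℝ≥0∞) ∂ν) < ⊤ →
        ∀ (x₀ : EuclideanSpace ℝ (Fin n)) (r : ℝ), c₃⁻¹ ≤ r → r ≤ c₃ →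
        ∀ φ : EuclideanSpace ℝ (Fin n) → ℝ,
          (∀ y, 0 ≤ φ y) →
          LipschitzWith (Real.toNNReal c₆) φ →
          (∀ y, y ∉ closedBall x₀ r → φ y = 0) →
          c₇ ≤ (∫ y, φ y ∂μ) →
          0 < (∫ y, φ y ∂ν) →
          Wp 1 (μ.withDensity fun y => ENNReal.ofReal (φ y))
              (ν.withDensity fun y =>
                ENNReal.ofReal ((∫ z, φ z ∂μ) / (∫ z, φ z ∂ν) * φ y)) ≤
            ENNReal.ofReal c * Wp 1 μ ν := by
  have hC : 0 < 7 * c₆ * c₃ := by positivity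
  refine ⟨7 * c₆ * c₃, hC, ?_⟩
  intro μ ν _ _ _ _ x₀ r hr₁ hr₂ φ hφ0 hφ hs hm hk
  have hr : 0 < r := (inv_pos.2 hc₃).trans_le hr₁
  refine le_mul_Wp_one (by simpa using hC) ENNReal.ofReal_ne_top fun π hπ₁ hπ₂ => ?_
  have hm0 : 0 < ∫ y, φ y ∂μ := hc₇.trans_le hm
  have hμi : Integrable φ μ := .of_integral_ne_zero hm0.ne'
  have hνi : Integrable φ ν := .of_integral_ne_zero hk.ne'
  have hmI := ofReal_integral_eq_lintegral_ofReal hμi (.of_forall hφ0)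
  have hkI := ofReal_integral_eq_lintegral_ofReal hνi (.of_forall hφ0)
  set m := ∫ y, φ y ∂μ
  set k := ∫ y, φ y ∂ν
  set a := m / k with ha
  have ha0 : 0 < a := div_pos hm0 hk
  have hφm : Measurable φ := hφ.continuous.measurable
  have hf : Measurable fun y => ENNReal.ofReal (φ y) := hφm.ennreal_ofReal
  have hg : Measurable fun y => ENNReal.ofReal (a * φ y) := (hφm.const_mul a).ennreal_ofReal
  have hgI : ∫⁻ y, ENNReal.ofReal (a * φ y) ∂ν = ENNReal.ofReal m := by
    simp_rw [ENNReal.ofReal_mul ha0.le]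
    rw [lintegral_const_mul _ hf, ← hkI, ← ENNReal.ofReal_mul ha0.le, ha, div_mul_cancel₀ _ hk.ne']
  have hfπ : ∫⁻ z, ENNReal.ofReal (φ z.1) ∂π = ENNReal.ofReal m := by
    rw [hmI, ← hπ₁, lintegral_map hf measurable_fst]
  have hgπ : ∫⁻ z, ENNReal.ofReal (a * φ z.2) ∂π = ENNReal.ofReal m := by
    rw [← hgI, ← hπ₂, lintegral_map hg measurable_snd]
  have hsupp : ∀ x, φ x ≠ 0 → edist x x₀ ≤ ENNReal.ofReal r := fun x hx => by
    rw [edist_dist]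
    exact ENNReal.ofReal_le_ofReal (by by_contra h; exact hx (hs x h))
  have key := Wp_one_withDensity_le π hf hg (hfπ.trans hgπ.symm)
    (by rw [hfπ]; exact ENNReal.ofReal_ne_top) x₀ (r := ENNReal.ofReal r)
    (fun x hx => hsupp x fun h => hx (by simp [h]))
    (fun x hx => hsupp x fun h => hx (by simp [h]))
  rw [hπ₁, hπ₂] at key
  refine key.trans ?_
  have hd : Measurable fun z : EuclideanSpace ℝ (Fin n) × EuclideanSpace ℝ (Fin n) =>
    edist z.1 z.2 := measurable_fst.edist measurable_snd
  set W := ∫⁻ z, edist z.1 z.2 ∂π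
  have hlip : ∀ x y, ENNReal.ofReal (φ x) ≤
      ENNReal.ofReal (φ y) + ENNReal.ofReal c₆ * edist x y := fun x y => by
    rw [edist_dist, ← ENNReal.ofReal_mul hc₆.le,
      ← ENNReal.ofReal_add (hφ0 y) (by positivity)]
    refine ENNReal.ofReal_le_ofReal ?_
    have h := hφ.dist_le_mul x y
    rw [Real.dist_eq, Real.coe_toNNReal _ hc₆.le] at h
    linarith [le_abs_self (φ x - φ y)]
  have hcommon : ∫⁻ z, min (ENNReal.ofReal (φ z.1)) (ENNReal.ofReal (a * φ z.2)) *
      edist z.1 z.2 ∂π ≤ ENNReal.ofReal (c₆ * (3 * c₃)) * W := by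
    rw [← lintegral_const_mul _ hd]
    refine lintegral_mono fun z => ?_
    by_cases hz : z.1 = z.2
    · simp [hz]
    · have : Nontrivial (EuclideanSpace ℝ (Fin n)) := ⟨_, _, hz⟩
      refine mul_le_mul_left ((min_le_left _ _).trans (ENNReal.ofReal_le_ofReal ?_)) _
      have h := hφ.le_of_support_subset_closedBall hr hs z.1
      rw [Real.coe_toNNReal _ hc₆.le] at h
      exact h.trans (by gcongr)
  have hkm : ENNReal.ofReal k ≤ ENNReal.ofReal m + ENNReal.ofReal c₆ * W := by
    rw [hkI, ← hfπ, ← hπ₂, lintegral_map hf measurable_snd, ← lintegral_const_mul _ hd,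
      ← lintegral_add_right _ (hd.const_mul _)]
    exact lintegral_mono fun z => by simpa [edist_comm] using hlip z.2 z.1
  have hscale : ∫⁻ y, (ENNReal.ofReal (φ y) - ENNReal.ofReal (a * φ y)) ∂ν ≤
      ENNReal.ofReal c₆ * W := by
    rcases le_total 1 a with h1 | h1
    · have : ∀ y, ENNReal.ofReal (φ y) - ENNReal.ofReal (a * φ y) = 0 := fun y =>
        tsub_eq_zero_of_le (ENNReal.ofReal_le_ofReal (le_mul_of_one_le_left (hφ0 y) h1))
      simp [this]
    · rw [lintegral_sub hg (by rw [hgI]; exact ENNReal.ofReal_ne_top) (.of_forall fun y =>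
        ENNReal.ofReal_le_ofReal (mul_le_of_le_one_left (hφ0 y) h1)), ← hkI, hgI]
      exact tsub_le_iff_left.2 hkm
  have hrest : ∫⁻ z, (ENNReal.ofReal (φ z.1) - ENNReal.ofReal (a * φ z.2)) ∂π ≤
      2 * ENNReal.ofReal c₆ * W := by
    calc _ ≤ ∫⁻ z, (ENNReal.ofReal c₆ * edist z.1 z.2 +
          (ENNReal.ofReal (φ z.2) - ENNReal.ofReal (a * φ z.2))) ∂π :=
          lintegral_mono fun z => by
            rw [tsub_le_iff_right, add_assoc]
            refine (hlip z.1 z.2).trans ?_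
            rw [add_comm]
            gcongr
            exact le_tsub_add
      _ = ENNReal.ofReal c₆ * W +
          ∫⁻ y, (ENNReal.ofReal (φ y) - ENNReal.ofReal (a * φ y)) ∂ν := by
          rw [lintegral_add_left (hd.const_mul _), lintegral_const_mul _ hd, ← hπ₂,
            lintegral_map (f := fun y => ENNReal.ofReal (φ y) - ENNReal.ofReal (a * φ y))
              (hf.sub hg) measurable_snd]
      _ ≤ _ := by
          rw [mul_assoc, two_mul]
          gcongr
  calc _ ≤ ENNReal.ofReal (c₆ * (3 * c₃)) * W +
        2 * ENNReal.ofReal c₃ * (2 * ENNReal.ofReal c₆ * W) := by gcongr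
    _ = ENNReal.ofReal (7 * c₆ * c₃) * W := by
        have h7 : 7 * c₆ * c₃ = c₆ * (3 * c₃) + 2 * c₃ * (2 * c₆) := by ring
        rw [h7, ENNReal.ofReal_add (by positivity) (by positivity),
          ENNReal.ofReal_mul (p := 2 * c₃) (by positivity),
          ENNReal.ofReal_mul (p := 2) (q := c₃) (by norm_num),
          ENNReal.ofReal_mul (p := 2) (q := c₆) (by norm_num), ENNReal.ofReal_ofNat]
        ring
end
end
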